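/- arXiv:1903.02936 — 3 statements merged into one kernel-verified Lean document; each statement's English description precedes it below -/
import Mathlib

section
/- (Bochner–Minlos–Sazonov theorem.) Let g : 𝒮(ℝ) → ℂ be a functional on the Schwartz space. There exists a probability measure μ on 𝒮'(ℝ) (equipped with the Borel σ-algebra of the weak-* topology) such that ∫_{𝒮'(ℝ)} e^{i⟨ω,φ⟩} dμ(ω) = g(φ) for all φ ∈ 𝒮(ℝ), if and only if the following three conditions hold: (i) g(0) = 1; (ii) g is continuous with respect to the Fréchet topology of 𝒮(ℝ); (iii) g is positive definite, i.e. for every n ∈ ℕ, all z₁,…,zₙ ∈ ℂ and all φ₁,…,φₙ ∈ 𝒮(ℝ), the sum Σ_{j,ℓ=1}^n z_j·conj(z_ℓ)·g(φ_j − φ_ℓ) is a nonnegative real number. -/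
open MeasureTheory
open scoped ComplexOrder

noncomputable section

/-- The Schwartz space `𝒮(ℝ)` of rapidly decreasing smooth real functions. -/
abbrev SchwartzR := SchwartzMap ℝ ℝ

/-- The space of tempered distributions `𝒮'(ℝ)`, i.e. the topological dual of the
Schwartz space equipped with the weak-* topology. -/
abbrev TemperedDistR := WeakDual ℝ SchwartzR

/-- The Borel σ-algebra of the weak-* topology on `𝒮'(ℝ)`. -/
instance : MeasurableSpace TemperedDistR := borel TemperedDistR

/-- A complex function on an additive group is positive definite. -/
def IsPosDefFun {V : Type*} [AddCommGroup V] (g : V → ℂ) : Prop :=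
  ∀ (n : ℕ) (z : Fin n → ℂ) (φ : Fin n → V),
    0 ≤ ∑ j, ∑ l, z j * (starRingEnd ℂ) (z l) * g (φ j - φ l)

namespace IsPosDefFun

variable {V : Type*} [AddCommGroup V] {g : V → ℂ}

lemma comp_addMonoidHom {W : Type*} [AddCommGroup W] (hg : IsPosDefFun g) (f : W →+ V) :
    IsPosDefFun (g ∘ f) := by
  intro n z φ
  simpa using hg n z (f ∘ φ)

lemma mul_char (hg : IsPosDefFun g) (e : V → ℂ)
    (he : ∀ x y, e (x - y) = e x * (starRingEnd ℂ) (e y)) :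
    IsPosDefFun (fun x ↦ e x * g x) := by
  intro n z φ
  refine (hg n (fun j ↦ z j * e (φ j)) φ).trans_eq ?_
  refine Finset.sum_congr rfl fun j _ ↦ Finset.sum_congr rfl fun l _ ↦ ?_
  simp only [he, map_mul]
  ring

lemma norm_le_one (hg : IsPosDefFun g) (h0 : g 0 = 1) (x : V) : ‖g x‖ ≤ 1 := by
  have key : ∀ c : ℂ, 0 ≤ 1 + (starRingEnd ℂ) c * g x + (c * g (-x) + c * (starRingEnd ℂ) c) := by
    intro c
    simpa [Fin.sum_univ_two, h0] using hg 2 ![1, c] ![x, 0]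
  have h1 := (Complex.le_def.1 (key 1)).2
  have h2 := (Complex.le_def.1 (key Complex.I)).2
  simp at h1 h2
  have h3 : g (-x) = (starRingEnd ℂ) (g x) := by
    apply Complex.ext <;> simp <;> linarith
  by_cases hx : g x = 0
  · simp [hx]
  have hn : (0 : ℝ) < ‖g x‖ := norm_pos_iff.2 hx
  have h4 := (Complex.le_def.1 (key (-(g x) / ‖g x‖))).1
  rw [h3] at h4
  have e1 : (starRingEnd ℂ) (-(g x) / ‖g x‖) * g x = -(‖g x‖ : ℂ) := by
    rw [map_div₀, map_neg, Complex.conj_ofReal, neg_div, neg_mul, div_mul_eq_mul_div, mul_comm,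
      Complex.mul_conj, Complex.normSq_eq_norm_sq]
    have : (‖g x‖ : ℂ) ≠ 0 := by exact_mod_cast hn.ne'
    push_cast
    field_simp
  have e2 : (-(g x) / ‖g x‖) * (starRingEnd ℂ) (g x) = -(‖g x‖ : ℂ) := by
    have := congrArg (starRingEnd ℂ) e1
    simpa using this
  have e3 : (-(g x) / ‖g x‖) * (starRingEnd ℂ) (-(g x) / ‖g x‖) = 1 := by
    rw [Complex.mul_conj, Complex.normSq_eq_norm_sq]
    simp [hn.ne']
  rw [e1, e2, e3] at h4
  simp at h4
  linarith

end IsPosDefFun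

/-- A bounded measurable kernel, all of whose finite double sums are nonnegative, has nonnegative
double integral against any probability measure. -/
lemma integral_prod_nonneg_of_sum_nonneg {E : Type*} [MeasurableSpace E] (ρ : Measure E)
    [IsProbabilityMeasure ρ] {G : E × E → ℂ} (hGm : Measurable G) {C : ℝ} (hGb : ∀ p, ‖G p‖ ≤ C)
    (hG : ∀ (n : ℕ) (x : Fin n → E), 0 ≤ ∑ j, ∑ l, G (x j, x l)) :
    0 ≤ ∫ p, G p ∂(ρ.prod ρ) := by
  set I := ∫ p, G p ∂(ρ.prod ρ) with hI
  set J := ∫ x, G (x, x) ∂ρ with hJ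
  have key : ∀ n : ℕ, 0 ≤ (n : ℂ) * J + (n : ℂ) * ((n : ℂ) - 1) * I := by
    intro n
    let P : Measure (Fin n → E) := Measure.pi (fun _ ↦ ρ)
    have hint : ∀ j l, Integrable (fun x : Fin n → E ↦ G (x j, x l)) P := fun j l ↦
      Integrable.of_bound (hGm.comp (by fun_prop)).aestronglyMeasurable C
        (Filter.Eventually.of_forall fun x ↦ hGb _)
    have hdiag : ∀ j, ∫ x, G (x j, x j) ∂P = J := by
      intro j
      have := (measurePreserving_eval (fun _ : Fin n ↦ ρ) j)
      rw [hJ, ← this.map_eq, integral_map (measurable_pi_apply j).aemeasurable]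
      · exact (hGm.comp (by fun_prop : Measurable fun x : E ↦ (x, x))).aestronglyMeasurable
    have hoff : ∀ j l, j ≠ l → ∫ x, G (x j, x l) ∂P = I := by
      intro j l hjl
      have hind : ProbabilityTheory.iIndepFun (fun (i : Fin n) (x : Fin n → E) ↦ x i) P :=
        ProbabilityTheory.iIndepFun_pi (X := fun _ x ↦ x) (fun i ↦ by fun_prop)
      have h2 := (ProbabilityTheory.indepFun_iff_map_prod_eq_prod_map_map
        (measurable_pi_apply j).aemeasurable (measurable_pi_apply l).aemeasurable).1
        (hind.indepFun hjl)
      have hm : ∀ j, P.map (fun x ↦ x j) = ρ := fun j ↦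
        (measurePreserving_eval (fun _ : Fin n ↦ ρ) j).map_eq
      rw [hm, hm] at h2
      rw [hI, ← h2, integral_map (Measurable.aemeasurable (by fun_prop)) hGm.aestronglyMeasurable]
    have hsum : ∫ x, ∑ j, ∑ l, G (x j, x l) ∂P = (n : ℂ) * J + (n : ℂ) * ((n : ℂ) - 1) * I := by
      rw [integral_finsetSum _ (fun j _ ↦ integrable_finsetSum _ fun l _ ↦ hint j l)]
      simp_rw [integral_finsetSum _ (fun l _ ↦ hint _ l)]
      have : ∀ j l, ∫ x, G (x j, x l) ∂P = I + if j = l then J - I else 0 := by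
        intro j l
        split_ifs with h
        · subst h; rw [hdiag]; ring
        · rw [hoff j l h, add_zero]
      simp_rw [this, Finset.sum_add_distrib]
      simp
      ring
    rw [← hsum]
    exact integral_nonneg fun x ↦ hG n x
  have him : ∀ n : ℕ, (n : ℝ) * J.im + n * (n - 1) * I.im = 0 := by
    intro n
    have := (Complex.le_def.1 (key n)).2
    simp at this
    linarith
  have hre : ∀ n : ℕ, 0 ≤ (n : ℝ) * J.re + n * (n - 1) * I.re := by
    intro n
    have := (Complex.le_def.1 (key n)).1
    simp at this
    linarith
  rw [Complex.le_def]
  constructor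
  · simp only [Complex.zero_re]
    by_contra! hneg
    obtain ⟨n, hn⟩ := exists_nat_gt (|J.re| / (-I.re))
    have h1 := hre (n + 2)
    rw [div_lt_iff₀ (by linarith)] at hn
    push_cast at h1
    have h2 : 0 ≤ J.re + (n + 1) * I.re := by
      have h3 : 0 ≤ ((n : ℝ) + 2) * (J.re + (n + 1) * I.re) := by linarith
      exact nonneg_of_mul_nonneg_right h3 (by positivity)
    linarith [le_abs_self J.re]
  · have h1 := him 1
    have h2 := him 2
    simp at h1 h2 ⊢
    rw [h1] at h2
    linarith

/-- A tight sequence of probability measures has a cluster point: a probability measure with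
respect to which the integrals of bounded continuous functions are the limits of the integrals
along the sequence, whenever these limits exist. -/
lemma exists_isProbabilityMeasure_integral_eq_of_isTight {X : Type*} [TopologicalSpace X]
    [T2Space X] [MeasurableSpace X] [BorelSpace X] (μ : ℕ → Measure X)
    [hμ : ∀ n, IsProbabilityMeasure (μ n)]
    (ht : IsTightMeasureSet (Set.range μ)) :
    ∃ ν : Measure X, IsProbabilityMeasure ν ∧ ∀ (f : BoundedContinuousFunction X ℂ) (c : ℂ),
      Filter.Tendsto (fun n ↦ ∫ x, f x ∂(μ n)) Filter.atTop (nhds c) → ∫ x, f x ∂ν = c := by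
  let P : ℕ → ProbabilityMeasure X := fun n ↦ ⟨μ n, hμ n⟩
  have hc : IsCompact (closure (Set.range P)) := by
    refine isCompact_closure_of_isTightMeasureSet ?_
    convert ht using 1
    ext ν
    exact ⟨fun ⟨_, ⟨n, hn⟩, h⟩ ↦ ⟨n, by rw [← h, ← hn]; rfl⟩,
      fun ⟨n, hn⟩ ↦ ⟨P n, ⟨n, rfl⟩, hn⟩⟩
  obtain ⟨ν, -, hν : Filter.Tendsto P (Filter.hyperfilter ℕ) (nhds ν)⟩ :=
    hc.ultrafilter_le_nhds ((Filter.hyperfilter ℕ).map P)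
      (Filter.le_principal_iff.2 (Filter.mem_map.2 (Filter.univ_mem' fun n ↦
        subset_closure (Set.mem_range_self n))))
  refine ⟨ν, inferInstance, fun f c hf ↦ ?_⟩
  rw [ProbabilityMeasure.tendsto_iff_forall_integral_rclike_tendsto ℂ] at hν
  have hle : (Filter.hyperfilter ℕ : Filter ℕ) ≤ Filter.atTop := by
    rw [← Nat.cofinite_eq_atTop]
    exact Filter.hyperfilter_le_cofinite
  exact tendsto_nhds_unique (hν f) (hf.mono_left hle)

section FiniteDimensional

open scoped FourierTransform RealInnerProductSpace

variable {E : Type*} [NormedAddCommGroup E] [InnerProductSpace ℝ E] [FiniteDimensional ℝ E]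
  [MeasurableSpace E] [BorelSpace E]

lemma integrable_exp_neg_mul_sq_norm {b : ℝ} (hb : 0 < b) :
    Integrable (fun x : E ↦ Real.exp (-b * ‖x‖ ^ 2)) := by
  have h := (GaussianFourier.integrable_cexp_neg_mul_sq_norm_add (V := E) (b := (b : ℂ))
    (by simpa using hb) 0 0).norm
  refine h.congr (Filter.Eventually.of_forall fun x ↦ ?_)
  simp only [Complex.norm_exp]
  congr 1
  simp [← Complex.ofReal_pow]

/-- The Gaussian-weighted Lebesgue integral of a bounded continuous positive definite function
is nonnegative. -/
lemma IsPosDefFun.integral_gaussian_mul_nonneg {k : E → ℂ} (hk : IsPosDefFun k)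
    (hkc : Continuous k) (hkb : ∀ x, ‖k x‖ ≤ 1) {b : ℝ} (hb : 0 < b) :
    0 ≤ ∫ t, (Real.exp (-(b / 2) * ‖t‖ ^ 2) : ℂ) * k t := by
  have hint := integrable_exp_neg_mul_sq_norm (E := E) hb
  set ρ : Measure E := volume.tilted (fun x ↦ -b * ‖x‖ ^ 2) with hρ
  have : IsProbabilityMeasure ρ := isProbabilityMeasure_tilted hint
  set Z : ℝ := ∫ x : E, Real.exp (-b * ‖x‖ ^ 2) with hZ
  have hZ0 : 0 < Z := integral_exp_pos hint
  have hm : Measurable (fun p : E × E ↦ k (p.1 - p.2)) := by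
    have := hkc.measurable
    fun_prop
  have hpos := integral_prod_nonneg_of_sum_nonneg ρ hm (C := 1) (fun p ↦ hkb _) (fun n x ↦ by
    simpa using hk n (fun _ ↦ 1) x)
  rw [integral_prod_symm _ (Integrable.of_bound hm.aestronglyMeasurable 1
    (Filter.Eventually.of_forall fun p ↦ hkb _))] at hpos
  simp only [hρ, integral_tilted, ← hZ] at hpos
  set F : E × E → ℂ := fun p ↦
    ((Real.exp (-b * ‖p.2 + p.1‖ ^ 2) * Real.exp (-b * ‖p.1‖ ^ 2) : ℝ) : ℂ) * k p.2 with hF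
  have hFint : Integrable F := by
    have hdom : Integrable (fun p : E × E ↦
        Real.exp (-(b / 4) * ‖p.1‖ ^ 2) * Real.exp (-(b / 4) * ‖p.2‖ ^ 2)) :=
      Integrable.mul_prod (integrable_exp_neg_mul_sq_norm (by positivity))
        (integrable_exp_neg_mul_sq_norm (by positivity))
    refine hdom.mono' (Continuous.aestronglyMeasurable (by fun_prop))
      (Filter.Eventually.of_forall fun p ↦ ?_)
    rw [hF, norm_mul, Complex.norm_real, Real.norm_of_nonneg (by positivity)]
    refine (mul_le_of_le_one_right (by positivity) (hkb _)).trans ?_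
    rw [← Real.exp_add, ← Real.exp_add]
    refine Real.exp_le_exp.2 ?_
    have h1 := norm_add_sq_real p.2 p.1
    have h2 := abs_le.1 (abs_real_inner_le_norm p.2 p.1)
    rw [h1]
    have h3 : 0 ≤ 3 / 4 * ‖p.2‖ ^ 2 + 2 * ⟪p.2, p.1⟫ + 7 / 4 * ‖p.1‖ ^ 2 := by
      nlinarith [sq_nonneg (‖p.2‖ - ‖p.1‖ * (4 / 3)), norm_nonneg p.1, norm_nonneg p.2,
        sq_nonneg (‖p.1‖)]
    nlinarith
  have e1 : ∫ y : E, (Real.exp (-b * ‖y‖ ^ 2) / Z) • ∫ x : E,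
      (Real.exp (-b * ‖x‖ ^ 2) / Z) • k (x - y) = ((Z ^ 2)⁻¹ : ℝ) • ∫ y : E, ∫ t : E, F (y, t) := by
    rw [← integral_smul (𝕜 := ℝ) (G := ℂ)]
    refine integral_congr_ae ?_
    filter_upwards with y
    rw [← integral_add_right_eq_self (fun x : E ↦ (Real.exp (-b * ‖x‖ ^ 2) / Z) • k (x - y)) y,
      ← integral_smul (𝕜 := ℝ) (G := ℂ), ← integral_smul (𝕜 := ℝ) (G := ℂ)]
    refine integral_congr_ae ?_
    filter_upwards with t
    simp only [hF, add_sub_cancel_right, Complex.real_smul]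
    push_cast
    field_simp
  have e2 : ∫ y : E, ∫ t : E, F (y, t) =
      ((∫ y : E, Real.exp (-(2 * b) * ‖y‖ ^ 2) : ℝ) : ℂ) *
        ∫ t, (Real.exp (-(b / 2) * ‖t‖ ^ 2) : ℂ) * k t := by
    rw [integral_integral_swap hFint, ← integral_const_mul]
    refine integral_congr_ae ?_
    filter_upwards with t
    simp only [hF]
    rw [integral_mul_const, integral_complex_ofReal,
      ← integral_add_right_eq_self (fun y : E ↦ Real.exp (-(2 * b) * ‖y‖ ^ 2)) ((1 / 2 : ℝ) • t),
      ← mul_assoc, ← Complex.ofReal_mul, ← integral_mul_const]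
    congr 3
    ext y
    rw [← Real.exp_add, ← Real.exp_add, norm_add_sq_real t y, norm_add_sq_real y,
      inner_smul_right, norm_smul, real_inner_comm]
    congr 1
    norm_num
    ring
  rw [e1, e2, Complex.real_smul, ← mul_assoc, ← Complex.ofReal_mul] at hpos
  have hc : 0 < (Z ^ 2)⁻¹ * ∫ y : E, Real.exp (-(2 * b) * ‖y‖ ^ 2) :=
    mul_pos (by positivity) (integral_exp_pos (integrable_exp_neg_mul_sq_norm (by positivity)))
  rw [Complex.le_def] at hpos ⊢
  rw [Complex.re_ofReal_mul, Complex.im_ofReal_mul] at hpos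
  simp only [Complex.zero_re, Complex.zero_im] at hpos ⊢
  refine ⟨nonneg_of_mul_nonneg_right hpos.1 hc, ?_⟩
  have := hpos.2.symm
  rw [mul_eq_zero] at this
  exact (this.resolve_left hc.ne').symm

/-- A continuous integrable function with nonnegative Fourier transform has an integrable Fourier
transform. -/
lemma integrable_fourier_of_nonneg {h : E → ℂ} (hc : Continuous h) (hi : Integrable h)
    (hF : ∀ w, 0 ≤ 𝓕 h w) : Integrable (𝓕 h) := by
  have hFc : Continuous (𝓕 h) := VectorFourier.fourierIntegral_continuous
    Real.continuous_fourierChar (by exact continuous_inner) hi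
  have hFre : ∀ w, ((𝓕 h w).re : ℂ) = 𝓕 h w := fun w ↦
    Complex.ext rfl (by simpa using (Complex.le_def.1 (hF w)).2)
  have hre0 : ∀ w, 0 ≤ (𝓕 h w).re := fun w ↦ (Complex.le_def.1 (hF w)).1
  have hlim : Filter.Tendsto (fun c : ℝ ↦ ∫ v : E, Complex.exp (-c⁻¹ * ‖v‖ ^ 2) • 𝓕 h v)
      Filter.atTop (nhds (h 0)) := by
    refine (Real.tendsto_integral_gaussian_smul' hi (v := 0) hc.continuousAt).congr' ?_
    filter_upwards [Filter.Ioi_mem_atTop 0] with c (hc : 0 < c)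
    have J : Integrable (fun w : E ↦ Complex.exp (-(c⁻¹ : ℝ) * ‖w‖ ^ 2)) := by
      simpa using GaussianFourier.integrable_cexp_neg_mul_sq_norm_add (V := E)
        (b := ((c⁻¹ : ℝ) : ℂ)) (by simpa using hc) 0 0
    have := VectorFourier.integral_fourierIntegral_smul_eq_flip (L := innerₗ E)
      Real.continuous_fourierChar continuous_inner J hi
    have key : ∫ w, 𝓕 (fun w : E ↦ Complex.exp (-(c⁻¹ : ℝ) * ‖w‖ ^ 2)) w • h w =
        ∫ v : E, Complex.exp (-(c⁻¹ : ℝ) * ‖v‖ ^ 2) • 𝓕 h v := by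
      simpa using! this
    rw [← key]
    congr with w
    rw [fourier_gaussian_innerProductSpace (by simpa)]
    congr 3
    · simp
    · simp
      ring
  have hlim' : Filter.Tendsto (fun n : ℕ ↦ ∫⁻ v : E,
      ENNReal.ofReal (Real.exp (-(n : ℝ)⁻¹ * ‖v‖ ^ 2) * (𝓕 h v).re))
      Filter.atTop (nhds (ENNReal.ofReal (h 0).re)) := by
    have h1 := (ENNReal.continuous_ofReal.comp Complex.continuous_re).continuousAt.tendsto.comp
      (hlim.comp tendsto_natCast_atTop_atTop)
    refine h1.congr' ?_
    filter_upwards [Filter.eventually_gt_atTop 0] with n hn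
    have hn' : (0 : ℝ) < (n : ℝ)⁻¹ := by positivity
    have hint : Integrable (fun v : E ↦ Real.exp (-(n : ℝ)⁻¹ * ‖v‖ ^ 2) * (𝓕 h v).re) := by
      refine (integrable_exp_neg_mul_sq_norm hn').mul_bdd (c := ∫ v, ‖h v‖)
        (by fun_prop) (Filter.Eventually.of_forall fun v ↦ ?_)
      exact (Complex.abs_re_le_norm _).trans
        (VectorFourier.norm_fourierIntegral_le_integral_norm _ _ _ _ _)
    rw [← ofReal_integral_eq_lintegral_ofReal hint
      (Filter.Eventually.of_forall fun v ↦ mul_nonneg (Real.exp_pos _).le (hre0 v))]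
    simp only [Function.comp]
    congr 1
    rw [← Complex.ofReal_re (∫ v : E, Real.exp (-(n : ℝ)⁻¹ * ‖v‖ ^ 2) * (𝓕 h v).re),
      ← integral_complex_ofReal]
    congr 2
    ext v
    rw [smul_eq_mul, Complex.ofReal_mul, hFre]
    simp
  have hfatou := lintegral_liminf_le' (μ := (volume : Measure E)) (u := Filter.atTop)
    (f := fun n : ℕ ↦ fun v : E ↦
    ENNReal.ofReal (Real.exp (-(n : ℝ)⁻¹ * ‖v‖ ^ 2) * (𝓕 h v).re))
    (fun n ↦ Measurable.aemeasurable (by have := hFc.measurable; fun_prop))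
  rw [hlim'.liminf_eq] at hfatou
  have hpt : ∀ v : E, Filter.liminf (fun n : ℕ ↦
      ENNReal.ofReal (Real.exp (-(n : ℝ)⁻¹ * ‖v‖ ^ 2) * (𝓕 h v).re)) Filter.atTop =
      ENNReal.ofReal (𝓕 h v).re := by
    intro v
    refine Filter.Tendsto.liminf_eq ((ENNReal.continuous_ofReal.tendsto _).comp ?_)
    have h2 : Filter.Tendsto (fun n : ℕ ↦ Real.exp (-(n : ℝ)⁻¹ * ‖v‖ ^ 2) * (𝓕 h v).re)
        Filter.atTop (nhds (Real.exp (-0 * ‖v‖ ^ 2) * (𝓕 h v).re)) :=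
      ((Real.continuous_exp.tendsto _).comp
        (tendsto_inv_atTop_nhds_zero_nat.neg.mul_const _)).mul_const _
    simpa using h2
  simp only [hpt] at hfatou
  refine ⟨hFc.aestronglyMeasurable, ?_⟩
  rw [hasFiniteIntegral_iff_norm]
  refine lt_of_le_of_lt (le_of_eq ?_) (hfatou.trans_lt ENNReal.ofReal_lt_top)
  congr 1
  ext v
  rw [← hFre v, Complex.norm_real, Real.norm_of_nonneg (hre0 v), Complex.ofReal_re]

/-- A continuous integrable function with nonnegative Fourier transform and value `1` at the
origin is a characteristic function. -/
lemma exists_charFun_eq_of_fourier_nonneg {h : E → ℂ} (hc : Continuous h) (hi : Integrable h)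
    (hF : ∀ w, 0 ≤ 𝓕 h w) (h0 : h 0 = 1) :
    ∃ μ : Measure E, IsProbabilityMeasure μ ∧ charFun μ = h := by
  have hFi := integrable_fourier_of_nonneg hc hi hF
  have hre0 : ∀ w, 0 ≤ (𝓕 h w).re := fun w ↦ (Complex.le_def.1 (hF w)).1
  have hFre : ∀ w, ((𝓕 h w).re : ℂ) = 𝓕 h w := fun w ↦
    Complex.ext rfl (by simpa using (Complex.le_def.1 (hF w)).2)
  set ν : Measure E := volume.withDensity (fun w ↦ ENNReal.ofReal (𝓕 h w).re) with hν
  have hνfin : IsFiniteMeasure ν := isFiniteMeasure_withDensity_ofReal hFi.re.2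
  have hchar : charFun (ν.map ((2 * Real.pi) • ·)) = h := by
    ext t
    rw [charFun_map_smul, charFun_apply, hν,
      integral_withDensity_eq_integral_toReal_smul₀
        (by have := hFi.aestronglyMeasurable.aemeasurable; fun_prop) (by simp)]
    have := congrFun (hc.fourierInv_fourier_eq hi hFi) t
    rw [Real.fourierInv_eq'] at this
    rw [← this]
    congr 1
    ext w
    rw [ENNReal.toReal_ofReal (hre0 w), Complex.real_smul, hFre, smul_eq_mul, mul_comm,
      inner_smul_right]
  have hfin : IsFiniteMeasure (ν.map ((2 * Real.pi) • · : E → E)) := by infer_instance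
  refine ⟨_, ⟨?_⟩, hchar⟩
  have h1 := congrFun hchar 0
  rw [charFun_zero, h0] at h1
  have h2 : (ν.map ((2 * Real.pi) • · : E → E)).real Set.univ = 1 := by exact_mod_cast h1
  rw [Measure.real] at h2
  rw [← ENNReal.ofReal_toReal (measure_ne_top _ _), h2, ENNReal.ofReal_one]

/-- **Bochner's theorem** on a finite-dimensional inner product space. -/
theorem IsPosDefFun.exists_charFun_eq {g : E → ℂ} (hg : IsPosDefFun g) (hgc : Continuous g)
    (h0 : g 0 = 1) : ∃ μ : Measure E, IsProbabilityMeasure μ ∧ charFun μ = g := by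
  have hb := hg.norm_le_one h0
  have key : ∀ n : ℕ, ∃ μ : Measure E, IsProbabilityMeasure μ ∧
      charFun μ = fun t ↦ (Real.exp (-((n : ℝ) + 1)⁻¹ * ‖t‖ ^ 2) : ℂ) * g t := by
    intro n
    have hs : (0 : ℝ) < ((n : ℝ) + 1)⁻¹ := by positivity
    refine exists_charFun_eq_of_fourier_nonneg (by fun_prop) ?_ ?_ (by simp [h0])
    · refine (integrable_exp_neg_mul_sq_norm (E := E) hs).mono'
        (Continuous.aestronglyMeasurable (by fun_prop)) (Filter.Eventually.of_forall fun x ↦ ?_)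
      rw [norm_mul, Complex.norm_real, Real.norm_of_nonneg (by positivity)]
      exact mul_le_of_le_one_right (by positivity) (hb x)
    · intro w
      have hk : IsPosDefFun (fun x ↦ (Real.fourierChar (-⟪x, w⟫) : ℂ) * g x) := by
        refine hg.mul_char (fun x ↦ (Real.fourierChar (-⟪x, w⟫) : ℂ)) fun x y ↦ ?_
        rw [← Circle.coe_inv_eq_conj, ← AddChar.map_neg_eq_inv, ← Circle.coe_mul,
          ← AddChar.map_add_eq_mul, inner_sub_left]
        congr 2
        ring
      have := hk.integral_gaussian_mul_nonneg (by fun_prop)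
        (fun x ↦ by rw [norm_mul, Circle.norm_coe, one_mul]; exact hb x) (b := 2 * ((n : ℝ) + 1)⁻¹)
        (by positivity)
      rw [Real.fourier_eq]
      refine this.trans_eq (integral_congr_ae ?_)
      filter_upwards with t
      rw [Circle.smul_def, smul_eq_mul, mul_left_comm, mul_div_cancel_left₀ _ (two_ne_zero' ℝ)]
  choose μ hμ hchar using key
  have hlim : ∀ t, Filter.Tendsto (fun n ↦ charFun (μ n) t) Filter.atTop (nhds (g t)) := by
    intro t
    have h1 : Filter.Tendsto (fun n : ℕ ↦ ((n : ℝ) + 1)⁻¹) Filter.atTop (nhds 0) := by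
      simpa using tendsto_one_div_add_atTop_nhds_zero_nat (𝕜 := ℝ)
    have h2 : Continuous fun s : ℝ ↦ (Real.exp (-s * ‖t‖ ^ 2) : ℂ) * g t := by fun_prop
    simpa [hchar, Function.comp_def] using (h2.tendsto 0).comp h1
  obtain ⟨ν, hν, h⟩ := exists_isProbabilityMeasure_integral_eq_of_isTight μ
    (isTightMeasureSet_of_tendsto_charFun hgc.continuousAt hlim)
  refine ⟨ν, hν, funext fun t ↦ ?_⟩
  rw [charFun_eq_integral_innerProbChar]
  refine h _ _ ?_
  simpa only [charFun_eq_integral_innerProbChar] using hlim t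

end FiniteDimensional

section TopologicalVectorSpace

variable {V : Type*} [AddCommGroup V] [Module ℝ V] [TopologicalSpace V] [IsTopologicalAddGroup V]
  [ContinuousSMul ℝ V]

/-- Finite-dimensional marginals of a continuous positive definite functional. -/
lemma IsPosDefFun.exists_charFun_eq_sum_smul {g : V → ℂ} (hg : IsPosDefFun g) (hgc : Continuous g)
    (h0 : g 0 = 1) {ι : Type*} [Fintype ι] (e : ι → V) :
    ∃ μ : Measure (EuclideanSpace ℝ ι), IsProbabilityMeasure μ ∧
      ∀ t, charFun μ t = g (∑ i, t i • e i) := by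
  let f : EuclideanSpace ℝ ι →+ V :=
    { toFun := fun t ↦ ∑ i, t i • e i
      map_zero' := by simp
      map_add' := fun x y ↦ by simp [add_smul, Finset.sum_add_distrib] }
  have hf : Continuous f := by
    change Continuous fun t : EuclideanSpace ℝ ι ↦ ∑ i, t i • e i
    fun_prop
  obtain ⟨μ, hμ, h⟩ := (hg.comp_addMonoidHom f).exists_charFun_eq (hgc.comp hf) (by simp [h0])
  exact ⟨μ, hμ, fun t ↦ congrFun h t⟩

/-- A sequence of measures on `ℕ → ℝ` with coordinate laws that are all either fixed or a
Dirac mass at `0` is tight. -/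
lemma isTightMeasureSet_range_of_map_eval (P : ℕ → Measure (ℕ → ℝ)) (ν : ℕ → Measure ℝ)
    [∀ k, IsProbabilityMeasure (ν k)]
    (hP : ∀ n k, (P n).map (fun a ↦ a k) = ν k ∨ (P n).map (fun a ↦ a k) = Measure.dirac 0) :
    IsTightMeasureSet (Set.range P) := by
  rw [isTightMeasureSet_iff_exists_isCompact_measure_compl_le]
  intro ε hε
  obtain ⟨ε', hε', hsum⟩ := ENNReal.exists_pos_sum_of_countable' hε.ne' ℕ
  have hK : ∀ k, ∃ K : Set ℝ, IsCompact K ∧ ν k Kᶜ ≤ ε' k := by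
    intro k
    obtain ⟨K, hK, h⟩ := isTightMeasureSet_iff_exists_isCompact_measure_compl_le.1
      (isTightMeasureSet_singleton (μ := ν k)) (ε' k) (hε' k)
    exact ⟨K, hK, h _ rfl⟩
  choose K hK hKν using hK
  refine ⟨Set.univ.pi fun k ↦ K k ∪ {0},
    isCompact_univ_pi fun k ↦ (hK k).union isCompact_singleton, ?_⟩
  rintro _ ⟨n, rfl⟩
  have hsub : (Set.univ.pi fun k ↦ K k ∪ {0})ᶜ ⊆ ⋃ k, (fun a : ℕ → ℝ ↦ a k) ⁻¹' (K k ∪ {0})ᶜ := by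
    intro a ha
    simpa [Set.mem_pi] using ha
  refine (measure_mono hsub).trans ((measure_iUnion_le _).trans
    ((ENNReal.tsum_le_tsum fun k ↦ ?_).trans hsum.le))
  have hm : MeasurableSet (K k ∪ {0})ᶜ :=
    ((hK k).measurableSet.union (measurableSet_singleton 0)).compl
  rw [← Measure.map_apply (measurable_pi_apply k) hm]
  rcases hP n k with h | h
  · rw [h]
    exact (measure_mono (Set.compl_subset_compl.2 Set.subset_union_left)).trans (hKν k)
  · rw [h, Measure.dirac_apply' _ hm]
    simp

/-- The evaluation of a linear combination, as a bounded continuous character on `ℕ → ℝ`. -/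
def linearCombinationChar (t : ℕ →₀ ℝ) : BoundedContinuousFunction (ℕ → ℝ) ℂ :=
  BoundedContinuousFunction.ofNormedAddCommGroup
    (fun a ↦ Complex.exp (Complex.I * ((Finsupp.linearCombination ℝ a t : ℝ) : ℂ)))
    (by simp only [Finsupp.linearCombination_apply, Finsupp.sum]; fun_prop) 1
    (fun a ↦ by rw [mul_comm, Complex.norm_exp_ofReal_mul_I])

lemma linearCombination_eq_sum_fin {W : Type*} [AddCommGroup W] [Module ℝ W] {t : ℕ →₀ ℝ} {n : ℕ}
    (ht : t.support ⊆ Finset.range n) (v : ℕ → W) :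
    Finsupp.linearCombination ℝ v t = ∑ i : Fin n, t i • v i := by
  rw [Finsupp.linearCombination_apply, Finsupp.sum_of_support_subset t ht _ (by simp),
    Finset.sum_range]

/-- Joint distribution of the values of a positive definite functional along a sequence. -/
lemma IsPosDefFun.exists_measure_nat {g : V → ℂ} (hg : IsPosDefFun g) (hgc : Continuous g)
    (h0 : g 0 = 1) (d : ℕ → V) :
    ∃ P : Measure (ℕ → ℝ), IsProbabilityMeasure P ∧ ∀ t : ℕ →₀ ℝ,
      ∫ a, Complex.exp (Complex.I * ((Finsupp.linearCombination ℝ a t : ℝ) : ℂ)) ∂P =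
        g (Finsupp.linearCombination ℝ d t) := by
  choose μ hμ hchar using fun n : ℕ ↦
    hg.exists_charFun_eq_sum_smul hgc h0 (fun i : Fin n ↦ d i)
  let Z : (n : ℕ) → EuclideanSpace ℝ (Fin n) → ℕ → ℝ := fun n x k ↦
    if h : k < n then x ⟨k, h⟩ else 0
  have hZ : ∀ n, Measurable (Z n) := fun n ↦ measurable_pi_iff.2 fun k ↦ by
    by_cases h : k < n
    · simp only [Z, h, dite_true]; fun_prop
    · simp only [Z, h, dite_false]; fun_prop
  let P : ℕ → Measure (ℕ → ℝ) := fun n ↦ (μ n).map (Z n)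
  have hPprob : ∀ n, IsProbabilityMeasure (P n) := fun n ↦
    Measure.isProbabilityMeasure_map (hZ n).aemeasurable
  have hint : ∀ (t : ℕ →₀ ℝ) (n : ℕ), t.support ⊆ Finset.range n →
      ∫ a, Complex.exp (Complex.I * ((Finsupp.linearCombination ℝ a t : ℝ) : ℂ)) ∂(P n) =
        g (Finsupp.linearCombination ℝ d t) := by
    intro t n ht
    have h1 := hchar n (WithLp.toLp 2 fun i : Fin n ↦ t i)
    rw [linearCombination_eq_sum_fin ht, ← h1, charFun_apply]
    refine (integral_map (hZ n).aemeasurable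
      (linearCombinationChar t).continuous.aestronglyMeasurable).trans ?_
    refine integral_congr_ae ?_
    filter_upwards with x
    simp only [linearCombinationChar, BoundedContinuousFunction.coe_ofNormedAddCommGroup]
    rw [linearCombination_eq_sum_fin ht, mul_comm]
    simp [Z, PiLp.inner_apply, mul_comm]
  have hν : ∀ k : ℕ, ∃ ν : Measure ℝ, IsProbabilityMeasure ν ∧ charFun ν = fun s ↦ g (s • d k) := by
    intro k
    exact (hg.comp_addMonoidHom
      (LinearMap.toSpanSingleton ℝ V (d k)).toAddMonoidHom).exists_charFun_eq
      (hgc.comp (by fun_prop : Continuous fun s : ℝ ↦ s • d k)) (by simp [h0])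
  choose ν hνp hνc using hν
  have htight : IsTightMeasureSet (Set.range P) := by
    refine isTightMeasureSet_range_of_map_eval P ν fun n k ↦ ?_
    by_cases h : k < n
    · left
      have := Measure.isProbabilityMeasure_map (μ := P n) (measurable_pi_apply k).aemeasurable
      refine Measure.ext_of_charFun ?_
      ext s
      rw [hνc, charFun_apply_real, integral_map (measurable_pi_apply k).aemeasurable
        (Continuous.aestronglyMeasurable (by fun_prop))]
      have := hint (Finsupp.single k s) n (Finsupp.support_single_subset.trans (by simpa using h))
      simp only [Finsupp.linearCombination_single] at this
      refine Eq.trans ?_ this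
      refine integral_congr_ae ?_
      filter_upwards with x
      simp [mul_comm]
    · right
      have : (fun a : ℕ → ℝ ↦ a k) ∘ Z n = fun _ ↦ 0 := by
        ext x; simp [Z, h]
      rw [Measure.map_map (measurable_pi_apply k) (hZ n), this, Measure.map_const]
      simp
  obtain ⟨Q, hQ, h⟩ := exists_isProbabilityMeasure_integral_eq_of_isTight P htight
  refine ⟨Q, hQ, fun t ↦ h (linearCombinationChar t) _ ?_⟩
  obtain ⟨n, hn⟩ := t.support.exists_nat_subset_range
  refine tendsto_const_nhds.congr' ?_
  filter_upwards [Filter.eventually_ge_atTop n] with m hm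
  exact (hint t m (hn.trans (Finset.range_mono hm))).symm

end TopologicalVectorSpace

section Minlos

open ProbabilityTheory
open scoped RealInnerProductSpace

lemma integral_norm_sq_sum_smul_stdGaussian {ι : Type*} [Fintype ι] {H : Type*}
    [NormedAddCommGroup H] [InnerProductSpace ℝ H] (v : ι → H) :
    Integrable (fun y : EuclideanSpace ℝ ι ↦ ‖∑ i, y i • v i‖ ^ 2)
        (stdGaussian (EuclideanSpace ℝ ι)) ∧
      ∫ y : EuclideanSpace ℝ ι, ‖∑ i, y i • v i‖ ^ 2 ∂(stdGaussian (EuclideanSpace ℝ ι)) =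
        ∑ i, ‖v i‖ ^ 2 := by
  classical
  set γ := stdGaussian (EuclideanSpace ℝ ι)
  have hL : MemLp id 2 γ := IsGaussian.memLp_two_id
  have hLi : ∀ i, MemLp (fun y : EuclideanSpace ℝ ι ↦ y i) 2 γ := fun i ↦
    (EuclideanSpace.proj i : EuclideanSpace ℝ ι →L[ℝ] ℝ).comp_memLp' hL
  have hint : ∀ i j, Integrable (fun y : EuclideanSpace ℝ ι ↦ y i * y j) γ := fun i j ↦
    (hLi i).integrable_mul (hLi j)
  have hval : ∀ i j, ∫ y : EuclideanSpace ℝ ι, y i * y j ∂γ = if i = j then 1 else 0 := by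
    intro i j
    have := covarianceBilin_apply hL (EuclideanSpace.single i (1 : ℝ)) (EuclideanSpace.single j 1)
    rw [covarianceBilin_stdGaussian] at this
    simp only [id, γ, integral_id_stdGaussian, sub_zero] at this
    simpa [EuclideanSpace.inner_single_left, innerSL_apply_apply ℝ, Pi.single_apply, eq_comm]
      using this.symm
  have hexp : ∀ y : EuclideanSpace ℝ ι,
      ‖∑ i, y i • v i‖ ^ 2 = ∑ i, ∑ j, (y i * y j) * ⟪v i, v j⟫ := by
    intro y
    rw [← real_inner_self_eq_norm_sq, sum_inner]
    simp_rw [inner_sum, inner_smul_left, inner_smul_right]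
    simp [mul_assoc]
  simp_rw [hexp]
  refine ⟨integrable_finsetSum _ fun i _ ↦ integrable_finsetSum _ fun j _ ↦
    (hint i j).mul_const _, ?_⟩
  rw [integral_finsetSum _ fun i _ ↦ integrable_finsetSum _ fun j _ ↦ (hint i j).mul_const _]
  simp_rw [integral_finsetSum _ fun j _ ↦ (hint _ j).mul_const _, integral_mul_const, hval]
  simp

/-- A tail bound for a measure on a Euclidean space from a quadratic bound on its
characteristic function. -/
lemma measure_norm_gt_le_of_charFun {ι : Type*} [Fintype ι] {H : Type*}
    [NormedAddCommGroup H] [InnerProductSpace ℝ H] (v : ι → H)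
    (μ : Measure (EuclideanSpace ℝ ι)) [IsProbabilityMeasure μ] {ε K R : ℝ} (hR : 0 < R)
    (hμ : ∀ y, 1 - (charFun μ y).re ≤ ε + K * ‖∑ i, y i • v i‖ ^ 2) :
    μ {x | R < ‖x‖} ≤ ENNReal.ofReal (3 * (ε + K / R ^ 2 * ∑ i, ‖v i‖ ^ 2)) := by
  set γ := stdGaussian (EuclideanSpace ℝ ι)
  obtain ⟨hvi, hv⟩ := integral_norm_sq_sum_smul_stdGaussian v
  have hswap : ∫ x, charFun γ (R⁻¹ • x) ∂μ = ∫ y, charFun μ (R⁻¹ • y) ∂γ := by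
    simp only [charFun_apply]
    rw [integral_integral_swap]
    · simp [inner_smul_right, real_inner_comm]
    · refine Integrable.of_bound (Continuous.aestronglyMeasurable ?_) 1
        (Filter.Eventually.of_forall fun p ↦ ?_)
      · simp only [Function.uncurry_def]
        fun_prop
      · simp [Function.uncurry_def, Complex.norm_exp_ofReal_mul_I]
  have hγ : ∀ x : EuclideanSpace ℝ ι,
      charFun γ (R⁻¹ • x) = ((Real.exp (-‖R⁻¹ • x‖ ^ 2 / 2) : ℝ) : ℂ) := by
    intro x
    rw [charFun_stdGaussian]
    push_cast
    rfl
  simp_rw [hγ] at hswap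
  rw [integral_complex_ofReal] at hswap
  have hchari : Integrable (fun y ↦ charFun μ (R⁻¹ • y)) γ :=
    Integrable.of_bound (Continuous.aestronglyMeasurable (by fun_prop)) 1
      (Filter.Eventually.of_forall fun y ↦ norm_charFun_le_one _)
  have hre := congrArg Complex.re hswap
  rw [Complex.ofReal_re, ← RCLike.re_to_complex, ← integral_re hchari] at hre
  have hexpi : Integrable (fun x : EuclideanSpace ℝ ι ↦ Real.exp (-‖R⁻¹ • x‖ ^ 2 / 2)) μ :=
    Integrable.of_bound (Continuous.aestronglyMeasurable (by fun_prop)) 1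
      (Filter.Eventually.of_forall fun y ↦ by
        rw [Real.norm_of_nonneg (Real.exp_pos _).le, Real.exp_le_one_iff]
        have := sq_nonneg ‖R⁻¹ • y‖
        linarith)
  have h1 : ∫ x, (1 - Real.exp (-‖R⁻¹ • x‖ ^ 2 / 2)) ∂μ ≤ ε + K / R ^ 2 * ∑ i, ‖v i‖ ^ 2 := by
    calc ∫ x, (1 - Real.exp (-‖R⁻¹ • x‖ ^ 2 / 2)) ∂μ
        = ∫ y, (1 - (charFun μ (R⁻¹ • y)).re) ∂γ := by
          have h := integral_sub (integrable_const (μ := γ) (1 : ℝ)) hchari.re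
          simp only [RCLike.re_to_complex] at h hre
          rw [integral_sub (integrable_const _) hexpi, hre, h]
          simp
      _ ≤ ∫ y, (ε + K / R ^ 2 * ‖∑ i, y i • v i‖ ^ 2) ∂γ := by
          refine integral_mono ((integrable_const _).sub hchari.re)
            ((integrable_const _).add (hvi.const_mul _)) fun y ↦ (hμ (R⁻¹ • y)).trans_eq ?_
          simp only [PiLp.smul_apply, smul_eq_mul, mul_smul, ← Finset.smul_sum, norm_smul,
            mul_pow, norm_inv, Real.norm_eq_abs, inv_pow, sq_abs]
          ring
      _ = ε + K / R ^ 2 * ∑ i, ‖v i‖ ^ 2 := by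
          rw [integral_add (integrable_const _) (hvi.const_mul _), integral_const_mul, hv]
          simp
  have hpos : ∀ x : EuclideanSpace ℝ ι, 0 ≤ 1 - Real.exp (-‖R⁻¹ • x‖ ^ 2 / 2) := by
    intro x
    have : Real.exp (-‖R⁻¹ • x‖ ^ 2 / 2) ≤ 1 := by
      rw [Real.exp_le_one_iff]
      have := sq_nonneg ‖R⁻¹ • x‖
      linarith
    linarith
  have h2 := mul_meas_ge_le_integral_of_nonneg (Filter.Eventually.of_forall hpos)
    ((integrable_const (μ := μ) (1 : ℝ)).sub hexpi) (1 / 3)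
  have hsub : {x : EuclideanSpace ℝ ι | R < ‖x‖} ⊆
      {x | 1 / 3 ≤ 1 - Real.exp (-‖R⁻¹ • x‖ ^ 2 / 2)} := by
    intro x (hx : R < ‖x‖)
    have h3 : 1 ≤ ‖R⁻¹ • x‖ := by
      rw [norm_smul, norm_inv, Real.norm_of_nonneg hR.le, inv_mul_eq_div, one_le_div hR]
      exact hx.le
    have h4 : Real.exp (-‖R⁻¹ • x‖ ^ 2 / 2) ≤ Real.exp (-(1 / 2)) :=
      Real.exp_le_exp.2 (by nlinarith)
    have h5 : Real.exp (-(1 / 2)) ≤ 2 / 3 := by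
      rw [Real.exp_neg, inv_le_comm₀ (Real.exp_pos _) (by norm_num)]
      have := Real.add_one_le_exp (1 / 2)
      linarith
    change (1 / 3 : ℝ) ≤ _
    linarith
  refine (measure_mono hsub).trans ?_
  rw [← ENNReal.ofReal_toReal (measure_ne_top μ _)]
  refine ENNReal.ofReal_le_ofReal ?_
  rw [Measure.real] at h2
  linarith

/-- Minlos' estimate: if `1 - Re g` is controlled by `Λp`, and `Λp` is Hilbert–Schmidt with respect
to `Λq`, then the values of the random functional along a sequence are, up to small probability,
bounded by a multiple of the `Λq`-norm. -/
lemma IsPosDefFun.measure_exists_lt_abs_le {V : Type*} [AddCommGroup V] [Module ℝ V]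
    [TopologicalSpace V] [IsTopologicalAddGroup V] [ContinuousSMul ℝ V] {g : V → ℂ}
    (hg : IsPosDefFun g) (hgc : Continuous g) (h0 : g 0 = 1) {H₁ H₂ : Type*}
    [NormedAddCommGroup H₁] [InnerProductSpace ℝ H₁] [NormedAddCommGroup H₂]
    [InnerProductSpace ℝ H₂] (Λp : V →ₗ[ℝ] H₁) (Λq : V →ₗ[ℝ] H₂) (hinj : Function.Injective Λq)
    {C : ℝ} (hC : ∀ (m : ℕ) (e : Fin m → V), Orthonormal ℝ (Λq ∘ e) → ∑ i, ‖Λp (e i)‖ ^ 2 ≤ C)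
    {ε K : ℝ} (hK : 0 ≤ K) (hest : ∀ φ, 1 - (g φ).re ≤ ε + K * ‖Λp φ‖ ^ 2) {R : ℝ} (hR : 0 < R)
    (d : ℕ → V) (P : Measure (ℕ → ℝ)) [IsProbabilityMeasure P]
    (hP : ∀ t : ℕ →₀ ℝ,
      ∫ a, Complex.exp (Complex.I * ((Finsupp.linearCombination ℝ a t : ℝ) : ℂ)) ∂P =
        g (Finsupp.linearCombination ℝ d t)) (n : ℕ) :
    P {a | ∃ t : ℕ →₀ ℝ, t.support ⊆ Finset.range n ∧
        R * ‖Λq (Finsupp.linearCombination ℝ d t)‖ < |Finsupp.linearCombination ℝ a t|} ≤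
      ENNReal.ofReal (3 * (ε + K / R ^ 2 * C)) := by
  let F : Submodule ℝ H₂ := (Submodule.span ℝ (Set.range fun k : Fin n ↦ d k)).map Λq
  have hFfin : FiniteDimensional ℝ F := by
    have : FiniteDimensional ℝ (Submodule.span ℝ (Set.range fun k : Fin n ↦ d k)) :=
      FiniteDimensional.span_of_finite ℝ (Set.finite_range _)
    infer_instance
  set b := stdOrthonormalBasis ℝ F
  have he : ∀ i, ∃ x : V, Λq x = b i := fun i ↦ by
    obtain ⟨x, -, hx⟩ := (b i).2
    exact ⟨x, hx⟩
  choose e he using he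
  have horth : Orthonormal ℝ (Λq ∘ e) := by
    have : Λq ∘ e = F.subtypeₗᵢ ∘ b := by ext i; simp [he]
    rw [this]
    exact b.orthonormal.comp_linearIsometry F.subtypeₗᵢ
  let c : Fin n → Fin (Module.finrank ℝ F) → ℝ := fun k i ↦ ⟪(b i : H₂), Λq (d k)⟫
  have hd : ∀ k, ∑ i, c k i • e i = d k := by
    intro k
    apply hinj
    have hmem : Λq (d k) ∈ F := Submodule.mem_map_of_mem (Submodule.subset_span ⟨k, rfl⟩)
    have := congrArg Subtype.val (b.sum_repr' ⟨Λq (d k), hmem⟩)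
    simpa [he, c] using this
  obtain ⟨μ, hμ, hchar⟩ := hg.exists_charFun_eq_sum_smul hgc h0 e
  let y : EuclideanSpace ℝ (Fin n) → EuclideanSpace ℝ (Fin (Module.finrank ℝ F)) := fun s ↦
    WithLp.toLp 2 fun i ↦ ∑ k, s k * c k i
  have hy : ∀ s, ∑ i, y s i • e i = ∑ k : Fin n, s k • d k := by
    intro s
    simp only [y, ← hd, Finset.sum_smul, Finset.smul_sum, smul_smul]
    exact Finset.sum_comm
  have hynorm : ∀ s, ‖Λq (∑ k : Fin n, s k • d k)‖ = ‖y s‖ := by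
    intro s
    have h1 : Λq (∑ k : Fin n, s k • d k) = ∑ i, y s i • (Λq ∘ e) i := by simp [← hy]
    rw [← sq_eq_sq₀ (norm_nonneg _) (norm_nonneg _), h1, ← real_inner_self_eq_norm_sq,
      horth.inner_sum, EuclideanSpace.norm_sq_eq]
    simp [sq]
  let L : EuclideanSpace ℝ (Fin (Module.finrank ℝ F)) → EuclideanSpace ℝ (Fin n) := fun x ↦
    WithLp.toLp 2 fun k ↦ ∑ i, x i * c k i
  have hLm : Measurable L := by
    refine Continuous.measurable ?_
    fun_prop
  have hL : ∀ x s, ⟪L x, s⟫ = ⟪x, y s⟫ := by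
    intro x s
    simp only [L, y, PiLp.inner_apply, RCLike.inner_apply, conj_trivial, Finset.mul_sum,
      Finset.sum_mul]
    rw [Finset.sum_comm]
    refine Finset.sum_congr rfl fun i _ ↦ Finset.sum_congr rfl fun k _ ↦ ?_
    ring
  let π : (ℕ → ℝ) → EuclideanSpace ℝ (Fin n) := fun a ↦ WithLp.toLp 2 fun k : Fin n ↦ a k
  have hπm : Measurable π := by
    refine Continuous.measurable ?_
    fun_prop
  have hmap : μ.map L = P.map π := by
    have h1 := Measure.isProbabilityMeasure_map (μ := μ) hLm.aemeasurable
    have h2 := Measure.isProbabilityMeasure_map (μ := P) hπm.aemeasurable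
    refine Measure.ext_of_charFun (funext fun s ↦ ?_)
    rw [charFun_apply, charFun_apply,
      integral_map hLm.aemeasurable (Continuous.aestronglyMeasurable (by fun_prop)),
      integral_map hπm.aemeasurable (Continuous.aestronglyMeasurable (by fun_prop))]
    simp_rw [hL]
    rw [← charFun_apply, hchar, hy]
    let t : ℕ →₀ ℝ := ∑ k : Fin n, Finsupp.single (k : ℕ) (s k)
    have h3 := hP t
    simp only [t, map_sum, Finsupp.linearCombination_single] at h3
    rw [← h3]
    refine integral_congr_ae ?_
    filter_upwards with a
    simp [π, PiLp.inner_apply, mul_comm]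
  let B : Set (EuclideanSpace ℝ (Fin n)) := ⋃ s : EuclideanSpace ℝ (Fin n),
    {v | R * ‖y s‖ < |⟪v, s⟫|}
  have hB : MeasurableSet B :=
    (isOpen_iUnion fun s ↦ isOpen_lt (by fun_prop) (by fun_prop)).measurableSet
  have hsub : {a : ℕ → ℝ | ∃ t : ℕ →₀ ℝ, t.support ⊆ Finset.range n ∧
        R * ‖Λq (Finsupp.linearCombination ℝ d t)‖ < |Finsupp.linearCombination ℝ a t|} ⊆
      π ⁻¹' B := by
    rintro a ⟨t, ht, h⟩
    rw [linearCombination_eq_sum_fin ht, linearCombination_eq_sum_fin ht] at h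
    refine Set.mem_iUnion.2 ⟨WithLp.toLp 2 fun k ↦ t k, ?_⟩
    change R * _ < |_|
    rw [← hynorm]
    simpa [π, PiLp.inner_apply, mul_comm] using h
  have hsub' : L ⁻¹' B ⊆ {x | R < ‖x‖} := by
    intro x hx
    obtain ⟨s, hs : R * ‖y s‖ < |⟪L x, s⟫|⟩ := Set.mem_iUnion.1 hx
    rw [hL] at hs
    have h1 := hs.trans_le (abs_real_inner_le_norm x (y s))
    exact lt_of_mul_lt_mul_right h1 (norm_nonneg _)
  calc _ ≤ P (π ⁻¹' B) := measure_mono hsub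
    _ = μ (L ⁻¹' B) := by rw [← Measure.map_apply hπm hB, ← hmap, Measure.map_apply hLm hB]
    _ ≤ μ {x | R < ‖x‖} := measure_mono hsub'
    _ ≤ ENNReal.ofReal (3 * (ε + K / R ^ 2 * ∑ i, ‖Λp (e i)‖ ^ 2)) :=
        measure_norm_gt_le_of_charFun (fun i ↦ Λp (e i)) μ hR fun x ↦ by
          rw [hchar]
          simpa using hest (∑ i, x i • e i)
    _ ≤ _ := by
        refine ENNReal.ofReal_le_ofReal ?_
        have := hC _ e horth
        gcongr

end Minlos

section Schwartz

/-- Differentiation on the Schwartz space. -/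
abbrev SchwartzR.diff : SchwartzR →L[ℝ] SchwartzR := SchwartzMap.derivCLM ℝ ℝ

/-- Multiplication by the coordinate on the Schwartz space. -/
abbrev SchwartzR.mulX : SchwartzR →L[ℝ] SchwartzR := SchwartzMap.smulLeftCLM ℝ fun x : ℝ ↦ x

lemma SchwartzR.mulX_apply (ψ : SchwartzR) (x : ℝ) : SchwartzR.mulX ψ x = x * ψ x := by
  have h : Function.HasTemperateGrowth fun x : ℝ ↦ x := by fun_prop
  simp [SchwartzR.mulX, SchwartzMap.smulLeftCLM_apply_apply h]

lemma SchwartzR.integrable_sq (ψ : SchwartzR) : Integrable fun x ↦ ψ x ^ 2 :=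
  (ψ.memLp 2 volume).integrable_sq

/-- A one-dimensional Sobolev inequality. -/
lemma SchwartzR.sq_apply_le (ψ : SchwartzR) (x : ℝ) :
    ψ x ^ 2 ≤ (∫ y, ψ y ^ 2) + ∫ y, SchwartzR.diff ψ y ^ 2 := by
  have hi := (ψ.integrable_sq).add (SchwartzR.integrable_sq (SchwartzR.diff ψ))
  have hbd : ∀ y, |2 * ψ y * SchwartzR.diff ψ y| ≤ ψ y ^ 2 + SchwartzR.diff ψ y ^ 2 := fun y ↦ by
    rw [abs_le]
    constructor <;>
      nlinarith [sq_nonneg (ψ y + SchwartzR.diff ψ y), sq_nonneg (ψ y - SchwartzR.diff ψ y)]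
  have hint : Integrable fun y ↦ 2 * ψ y * SchwartzR.diff ψ y := by
    refine hi.mono' (by fun_prop) (Filter.Eventually.of_forall hbd)
  have hder : ∀ y ∈ Set.Iic x, HasDerivAt (fun y ↦ ψ y ^ 2) (2 * ψ y * SchwartzR.diff ψ y) y := by
    intro y _
    simpa using (ψ.hasDerivAt y).fun_pow 2
  have hlim : Filter.Tendsto (fun y ↦ ψ y ^ 2) Filter.atBot (nhds 0) := by
    simpa using ((ψ.tendsto_cocompact).mono_left atBot_le_cocompact).pow 2
  have hftc := integral_Iic_of_hasDerivAt_of_tendsto' hder hint.integrableOn hlim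
  rw [sub_zero] at hftc
  rw [← hftc, ← integral_add ψ.integrable_sq (SchwartzR.integrable_sq (SchwartzR.diff ψ))]
  calc ∫ y in Set.Iic x, 2 * ψ y * SchwartzR.diff ψ y
      ≤ ∫ y in Set.Iic x, (ψ y ^ 2 + SchwartzR.diff ψ y ^ 2) :=
        setIntegral_mono hint.integrableOn hi.integrableOn fun y ↦ (le_abs_self _).trans (hbd y)
    _ ≤ ∫ y, (ψ y ^ 2 + SchwartzR.diff ψ y ^ 2) :=
        setIntegral_le_integral hi (Filter.Eventually.of_forall fun y ↦ by positivity)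

variable {ι : Type*}

/-- The Hilbert-space-valued map `φ ↦ (A i φ)ᵢ` attached to finitely many operators on the
Schwartz space. -/
def SchwartzR.sobolevMap (A : ι → SchwartzR →L[ℝ] SchwartzR) :
    SchwartzR →L[ℝ] PiLp 2 fun _ : ι ↦ Lp ℝ 2 (volume : Measure ℝ) :=
  ((PiLp.continuousLinearEquiv 2 ℝ fun _ : ι ↦ Lp ℝ 2 (volume : Measure ℝ)).symm :
      (∀ _ : ι, Lp ℝ 2 (volume : Measure ℝ)) →L[ℝ] _) ∘L
    ContinuousLinearMap.pi fun i ↦ SchwartzMap.toLpCLM ℝ ℝ 2 volume ∘L A i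

lemma SchwartzR.norm_toLp_two_sq (ψ : SchwartzR) : ‖ψ.toLp 2 volume‖ ^ 2 = ∫ y, ψ y ^ 2 := by
  rw [← real_inner_self_eq_norm_sq, L2.inner_def]
  refine integral_congr_ae ?_
  filter_upwards [ψ.coeFn_toLp 2 volume] with y hy
  simp [hy, sq]

lemma SchwartzR.norm_sobolevMap_sq [Fintype ι] (A : ι → SchwartzR →L[ℝ] SchwartzR)
    (φ : SchwartzR) : ‖SchwartzR.sobolevMap A φ‖ ^ 2 = ∑ i, ∫ y, A i φ y ^ 2 := by
  rw [PiLp.norm_sq_eq_of_L2]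
  exact Finset.sum_congr rfl fun i _ ↦ SchwartzR.norm_toLp_two_sq _

/-- Adjoin enough derivatives and weights to a family of operators to make the comparison of the
two Sobolev norms Hilbert–Schmidt. -/
def SchwartzR.enrich (A : ι → SchwartzR →L[ℝ] SchwartzR) :
    Option (ι × Fin 4) → SchwartzR →L[ℝ] SchwartzR
  | none => ContinuousLinearMap.id ℝ SchwartzR
  | some (i, j) => ![A i, SchwartzR.diff ∘L A i, SchwartzR.mulX ∘L A i,
      SchwartzR.diff ∘L SchwartzR.mulX ∘L A i] j

lemma SchwartzR.injective_sobolevMap_enrich (A : ι → SchwartzR →L[ℝ] SchwartzR) :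
    Function.Injective (SchwartzR.sobolevMap (SchwartzR.enrich A)) := fun _ _ h ↦
  SchwartzMap.injective_toLp 2 volume (congrArg (fun v ↦ v.ofLp none) h)

lemma SchwartzR.one_add_sq_mul_sq_le [Fintype ι] (A : ι → SchwartzR →L[ℝ] SchwartzR)
    (φ : SchwartzR) (i : ι) (y : ℝ) :
    (1 + y ^ 2) * A i φ y ^ 2 ≤ ‖SchwartzR.sobolevMap (SchwartzR.enrich A) φ‖ ^ 2 := by
  have h1 := SchwartzR.sq_apply_le (A i φ) y
  have h2 := SchwartzR.sq_apply_le (SchwartzR.mulX (A i φ)) y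
  rw [SchwartzR.mulX_apply] at h2
  have h3 : ∑ j : Fin 4, ∫ x, SchwartzR.enrich A (some (i, j)) φ x ^ 2 ≤
      ∑ i, ∑ j : Fin 4, ∫ x, SchwartzR.enrich A (some (i, j)) φ x ^ 2 :=
    Finset.single_le_sum (f := fun i ↦ ∑ j : Fin 4, ∫ x, SchwartzR.enrich A (some (i, j)) φ x ^ 2)
      (fun i _ ↦ Finset.sum_nonneg fun j _ ↦ integral_nonneg fun x ↦ sq_nonneg _)
      (Finset.mem_univ i)
  have h4 : 0 ≤ ∫ x, SchwartzR.enrich A none φ x ^ 2 := integral_nonneg fun x ↦ sq_nonneg _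
  rw [SchwartzR.norm_sobolevMap_sq, Fintype.sum_option, Fintype.sum_prod_type]
  rw [Fin.sum_univ_four] at h3
  simp only [SchwartzR.enrich, Matrix.cons_val, ContinuousLinearMap.comp_apply] at h3 h4 ⊢
  nlinarith

/-- The Sobolev map of a family is Hilbert–Schmidt with respect to that of its enrichment. -/
lemma SchwartzR.sum_norm_sobolevMap_sq_le [Fintype ι] (A : ι → SchwartzR →L[ℝ] SchwartzR)
    (m : ℕ) (e : Fin m → SchwartzR)
    (he : Orthonormal ℝ (SchwartzR.sobolevMap (SchwartzR.enrich A) ∘ e)) :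
    ∑ k, ‖SchwartzR.sobolevMap A (e k)‖ ^ 2 ≤ Fintype.card ι * Real.pi := by
  have key : ∀ i y, ∑ k, A i (e k) y ^ 2 ≤ (1 + y ^ 2)⁻¹ := by
    intro i y
    set c : Fin m → ℝ := fun k ↦ A i (e k) y
    have h := SchwartzR.one_add_sq_mul_sq_le A (∑ k, c k • e k) i y
    have h1 : A i (∑ k, c k • e k) y = ∑ k, c k ^ 2 := by
      simp [map_sum, c, sq]
    have h2 : ‖SchwartzR.sobolevMap (SchwartzR.enrich A) (∑ k, c k • e k)‖ ^ 2 = ∑ k, c k ^ 2 := by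
      have := he.inner_sum c c Finset.univ
      rw [← real_inner_self_eq_norm_sq]
      simp only [map_sum, map_smul]
      simpa [sq] using this
    rw [h1, h2] at h
    have h0 : 0 ≤ ∑ k, c k ^ 2 := Finset.sum_nonneg fun k _ ↦ sq_nonneg _
    rcases h0.eq_or_lt with h0 | h0
    · rw [show ∑ k, A i (e k) y ^ 2 = ∑ k, c k ^ 2 from rfl, ← h0]; positivity
    · rw [show ∑ k, A i (e k) y ^ 2 = ∑ k, c k ^ 2 from rfl, ← one_div, le_div_iff₀ (by positivity)]
      nlinarith
  calc ∑ k, ‖SchwartzR.sobolevMap A (e k)‖ ^ 2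
      = ∑ i, ∫ y, ∑ k, A i (e k) y ^ 2 := by
        simp_rw [SchwartzR.norm_sobolevMap_sq]
        rw [Finset.sum_comm]
        refine Finset.sum_congr rfl fun i _ ↦ ?_
        rw [integral_finsetSum _ fun k _ ↦ (SchwartzR.integrable_sq _)]
    _ ≤ ∑ _i : ι, Real.pi := by
        refine Finset.sum_le_sum fun i _ ↦ ?_
        rw [← integral_univ_inv_one_add_sq]
        exact integral_mono (integrable_finsetSum _ fun k _ ↦ SchwartzR.integrable_sq _)
          integrable_inv_one_add_sq (key i)
    _ = Fintype.card ι * Real.pi := by simp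

/-- The operators `φ ↦ x ^ k * φ⁽ⁿ⁾` and their derivatives, which generate the topology of the
Schwartz space in the `L²` sense. -/
def SchwartzR.weightedDeriv (p : ℕ × ℕ) (b : Bool) : SchwartzR →L[ℝ] SchwartzR :=
  if b then SchwartzR.diff ∘L (SchwartzR.mulX ^ p.1) ∘L (SchwartzR.diff ^ p.2)
  else (SchwartzR.mulX ^ p.1) ∘L (SchwartzR.diff ^ p.2)

lemma SchwartzR.diff_pow_apply (n : ℕ) (φ : SchwartzR) :
    ((SchwartzR.diff ^ n) φ : ℝ → ℝ) = iteratedDeriv n φ := by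
  induction n with
  | zero => simp
  | succ n ih =>
    rw [iteratedDeriv_succ, ← ih]
    ext x
    rw [pow_succ', mul_apply_eq_comp, SchwartzMap.derivCLM_apply]

lemma SchwartzR.mulX_pow_apply (k : ℕ) (φ : SchwartzR) (x : ℝ) :
    (SchwartzR.mulX ^ k) φ x = x ^ k * φ x := by
  induction k with
  | zero => simp
  | succ k ih =>
    rw [pow_succ', mul_apply_eq_comp, SchwartzR.mulX_apply, ih]
    ring

/-- The Sobolev map attached to a finite set of weights and orders of differentiation. -/
def SchwartzR.finsetSobolevMap (s : Finset (ℕ × ℕ)) :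
    SchwartzR →L[ℝ] PiLp 2 fun _ : s × Bool ↦ Lp ℝ 2 (volume : Measure ℝ) :=
  SchwartzR.sobolevMap fun j : s × Bool ↦ SchwartzR.weightedDeriv j.1 j.2

lemma SchwartzR.seminorm_le_norm_finsetSobolevMap {s : Finset (ℕ × ℕ)} {p : ℕ × ℕ} (hp : p ∈ s)
    (φ : SchwartzR) :
    schwartzSeminormFamily ℝ ℝ ℝ p φ ≤ ‖SchwartzR.finsetSobolevMap s φ‖ := by
  refine SchwartzMap.seminorm_le_bound' ℝ p.1 p.2 φ (norm_nonneg _) fun x ↦ ?_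
  have h := SchwartzR.sq_apply_le (SchwartzR.weightedDeriv p false φ) x
  have h1 : SchwartzR.weightedDeriv p false φ x = x ^ p.1 * iteratedDeriv p.2 φ x := by
    rw [← SchwartzR.diff_pow_apply, ← SchwartzR.mulX_pow_apply]
    rfl
  have h2 : SchwartzR.diff (SchwartzR.weightedDeriv p false φ) =
      SchwartzR.weightedDeriv p true φ := rfl
  have h3 : ∑ b : Bool, ∫ x, SchwartzR.weightedDeriv p b φ x ^ 2 ≤
      ‖SchwartzR.finsetSobolevMap s φ‖ ^ 2 := by
    rw [SchwartzR.finsetSobolevMap, SchwartzR.norm_sobolevMap_sq, Fintype.sum_prod_type]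
    have aux : ∀ F : s → ℝ, (∀ i, 0 ≤ F i) → F ⟨p, hp⟩ ≤ ∑ i, F i := fun F hF ↦
      Finset.single_le_sum (fun i _ ↦ hF i) (Finset.mem_univ _)
    exact aux (fun i ↦ ∑ b : Bool, ∫ x, SchwartzR.weightedDeriv i b φ x ^ 2)
      fun i ↦ Finset.sum_nonneg fun j _ ↦ integral_nonneg fun x ↦ sq_nonneg _
  rw [h1, h2, add_comm] at h
  rw [Fintype.sum_bool] at h3
  have h4 := abs_le_of_sq_le_sq (h.trans h3) (norm_nonneg _)
  rwa [abs_mul, abs_pow] at h4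

lemma SchwartzR.exists_norm_finsetSobolevMap_lt_mem {U : Set SchwartzR} (hU : U ∈ nhds 0) :
    ∃ s : Finset (ℕ × ℕ), ∃ δ > 0, ∀ φ, ‖SchwartzR.finsetSobolevMap s φ‖ < δ → φ ∈ U := by
  obtain ⟨s, r, hr, hs⟩ := ((schwartz_withSeminorms ℝ ℝ ℝ).mem_nhds_iff 0 U).1 hU
  refine ⟨s, r, hr, fun φ hφ ↦ hs ?_⟩
  rw [Seminorm.mem_ball_zero]
  exact Seminorm.finset_sup_apply_lt hr fun p hp ↦
    (SchwartzR.seminorm_le_norm_finsetSobolevMap hp φ).trans_lt hφ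

instance SchwartzR.instSecondCountableTopology : SecondCountableTopology SchwartzR := by
  have : Fact ((2 : ENNReal) ≠ ⊤) := ⟨by simp⟩
  let Φ : SchwartzR →+
      ∀ s : Finset (ℕ × ℕ), PiLp 2 fun _ : s × Bool ↦ Lp ℝ 2 (volume : Measure ℝ) :=
    { toFun := fun φ s ↦ SchwartzR.finsetSobolevMap s φ
      map_zero' := by ext1 s; simp
      map_add' := fun φ ψ ↦ by ext1 s; simp }
  have hΦ : Continuous Φ := continuous_pi fun s ↦ (SchwartzR.finsetSobolevMap s).continuous
  have hind : Topology.IsInducing Φ := by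
    rw [IsTopologicalAddGroup.isInducing_iff_nhds_zero]
    refine le_antisymm (by simpa using (hΦ.tendsto 0).le_comap) fun U hU ↦ ?_
    obtain ⟨s, δ, hδ, hs⟩ := SchwartzR.exists_norm_finsetSobolevMap_lt_mem hU
    refine ⟨{v | ‖v s‖ < δ}, ?_, fun φ hφ ↦ hs φ hφ⟩
    refine IsOpen.mem_nhds (isOpen_lt (by fun_prop) continuous_const) ?_
    simpa using hδ
  exact hind.secondCountableTopology

/-- A continuous functional on the Schwartz space is controlled near the origin by a Sobolev
norm. -/
lemma SchwartzR.exists_one_sub_re_le {g : SchwartzR → ℂ} (hgc : Continuous g) (h0 : g 0 = 1)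
    (hb : ∀ φ, ‖g φ‖ ≤ 1) {ε : ℝ} (hε : 0 < ε) : ∃ s : Finset (ℕ × ℕ), ∃ K : ℝ, 0 ≤ K ∧
      ∀ φ, 1 - (g φ).re ≤ ε + K * ‖SchwartzR.finsetSobolevMap s φ‖ ^ 2 := by
  have hU : {φ | 1 - (g φ).re < ε} ∈ nhds (0 : SchwartzR) := by
    refine IsOpen.mem_nhds (isOpen_lt (by fun_prop) continuous_const) ?_
    simpa [h0] using hε
  obtain ⟨s, δ, hδ, hs⟩ := SchwartzR.exists_norm_finsetSobolevMap_lt_mem hU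
  refine ⟨s, 2 / δ ^ 2, by positivity, fun φ ↦ ?_⟩
  rcases lt_or_ge ‖SchwartzR.finsetSobolevMap s φ‖ δ with h | h
  · have : 1 - (g φ).re < ε := hs φ h
    have : 0 ≤ 2 / δ ^ 2 * ‖SchwartzR.finsetSobolevMap s φ‖ ^ 2 := by positivity
    linarith
  · have h1 : -1 ≤ (g φ).re := (abs_le.1 ((Complex.abs_re_le_norm _).trans (hb φ))).1
    have h2 : 2 / δ ^ 2 * δ ^ 2 ≤ 2 / δ ^ 2 * ‖SchwartzR.finsetSobolevMap s φ‖ ^ 2 := by gcongr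
    have h3 : 2 / δ ^ 2 * δ ^ 2 = 2 := by field_simp
    linarith

end Schwartz

section Realization

/-- A linear functional prescribed on a sequence and dominated there by the norm of a continuous
linear map extends to a continuous linear functional. -/
lemma exists_weakDual_apply_eq {V H : Type*} [AddCommGroup V] [Module ℝ V] [TopologicalSpace V]
    [NormedAddCommGroup H] [NormedSpace ℝ H] (Λ : V →L[ℝ] H) (d : ℕ → V) (a : ℕ → ℝ) {R : ℝ}
    (ha : ∀ t : ℕ →₀ ℝ, |Finsupp.linearCombination ℝ a t| ≤
      R * ‖Λ (Finsupp.linearCombination ℝ d t)‖) :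
    ∃ ω : WeakDual ℝ V, ∀ k, ω (d k) = a k := by
  let L : (ℕ →₀ ℝ) →ₗ[ℝ] H := (Λ : V →ₗ[ℝ] H) ∘ₗ Finsupp.linearCombination ℝ d
  let l : (ℕ →₀ ℝ) →ₗ[ℝ] ℝ := Finsupp.linearCombination ℝ a
  have hker : LinearMap.ker L ≤ LinearMap.ker l := fun t ht ↦ by
    rw [LinearMap.mem_ker] at ht ⊢
    have h := ha t
    rw [show Λ (Finsupp.linearCombination ℝ d t) = 0 from ht, norm_zero, mul_zero] at h
    exact abs_nonpos_iff.1 h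
  let f₀ : LinearMap.range L →ₗ[ℝ] ℝ :=
    (LinearMap.ker L).liftQ l hker ∘ₗ (L.quotKerEquivRange.symm : LinearMap.range L →ₗ[ℝ] _)
  have hf₀ : ∀ t, f₀ ⟨L t, LinearMap.mem_range_self L t⟩ = l t := fun t ↦ by
    change (LinearMap.ker L).liftQ l hker (L.quotKerEquivRange.symm _) = l t
    rw [LinearMap.quotKerEquivRange_symm_apply_image]
    simp
  let f : StrongDual ℝ (LinearMap.range L) := f₀.mkContinuous R <| by
    rintro ⟨_, t, rfl⟩
    rw [hf₀]
    exact ha t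
  obtain ⟨F, hF, -⟩ := exists_extension_norm_eq (LinearMap.range L) f
  refine ⟨StrongDual.toWeakDual (F ∘L Λ), fun k ↦ ?_⟩
  have hk : L (Finsupp.single k 1) = Λ (d k) := by simp [L]
  have h := hF ⟨L (Finsupp.single k 1), LinearMap.mem_range_self L _⟩
  change F (Λ (d k)) = a k
  rw [← hk, h]
  change f₀ _ = _
  rw [hf₀]
  simp [l]

variable {V : Type*} [AddCommGroup V] [Module ℝ V] [TopologicalSpace V]

open scoped Classical in
/-- The continuous linear functional with given values along a sequence, if there is one. -/
def functionalOfSeq (d : ℕ → V) (a : ℕ → ℝ) : WeakDual ℝ V :=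
  if h : ∃ ω : WeakDual ℝ V, ∀ k, ω (d k) = a k then h.choose else 0

/-- The coefficient sequences dominated by `R` times the norm of `Λ`. -/
def dominatedSeq {H : Type*} [NormedAddCommGroup H] [NormedSpace ℝ H] (Λ : V →L[ℝ] H) (R : ℝ)
    (d : ℕ → V) : Set (ℕ → ℝ) :=
  {a | ∀ t : ℕ →₀ ℝ, |Finsupp.linearCombination ℝ a t| ≤
    R * ‖Λ (Finsupp.linearCombination ℝ d t)‖}

variable {H : Type*} [NormedAddCommGroup H] [NormedSpace ℝ H] {Λ : V →L[ℝ] H} {R : ℝ} {d : ℕ → V}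

lemma continuous_linearCombination_apply (t : ℕ →₀ ℝ) :
    Continuous fun a : ℕ → ℝ ↦ Finsupp.linearCombination ℝ a t := by
  simp only [Finsupp.linearCombination_apply, Finsupp.sum]
  fun_prop

lemma isClosed_dominatedSeq : IsClosed (dominatedSeq Λ R d) := by
  simp only [dominatedSeq, Set.ofPred_forall]
  exact isClosed_iInter fun t ↦
    isClosed_le (continuous_linearCombination_apply t).abs continuous_const

lemma functionalOfSeq_apply {a : ℕ → ℝ} (ha : a ∈ dominatedSeq Λ R d) (k : ℕ) :
    functionalOfSeq d a (d k) = a k := by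
  have h := exists_weakDual_apply_eq Λ d a ha
  rw [functionalOfSeq, dif_pos h]
  exact h.choose_spec k

lemma abs_functionalOfSeq_le (hd : DenseRange d) {a : ℕ → ℝ}
    (ha : a ∈ dominatedSeq Λ R d) (φ : V) : |functionalOfSeq d a φ| ≤ R * ‖Λ φ‖ := by
  induction φ using hd.induction_on with
  | hp => exact isClosed_le (by fun_prop) (by fun_prop)
  | ih k =>
    rw [functionalOfSeq_apply ha]
    simpa using ha (Finsupp.single k 1)

lemma continuousOn_functionalOfSeq [IsTopologicalAddGroup V] (hd : DenseRange d) :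
    ContinuousOn (functionalOfSeq d) (dominatedSeq Λ R d) := by
  rw [continuousOn_iff_continuous_domRestrict]
  refine WeakDual.continuous_of_continuous_eval fun φ ↦ ?_
  have hφ : ContinuousOn (fun a ↦ functionalOfSeq d a φ) (dominatedSeq Λ R d) := by
    refine continuousOn_of_uniform_approx_of_continuousOn fun u hu ↦ ?_
    obtain ⟨ε, hε, hεu⟩ := Metric.mem_uniformity_dist.1 hu
    have hopen : IsOpen {ψ | R * ‖Λ (φ - ψ)‖ < ε} := isOpen_lt (by fun_prop) continuous_const
    obtain ⟨k, hk⟩ := hd.exists_mem_open hopen ⟨φ, by simpa using hε⟩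
    refine ⟨fun a ↦ a k, (continuous_apply k).continuousOn, fun a ha ↦ hεu ?_⟩
    beta_reduce
    rw [Real.dist_eq, ← functionalOfSeq_apply ha k, ← map_sub]
    exact (abs_functionalOfSeq_le hd ha _).trans_lt hk
  exact continuousOn_iff_continuous_domRestrict.1 hφ

end Realization

instance TemperedDistR.instBorelSpace : BorelSpace TemperedDistR := ⟨rfl⟩

section CharacteristicFunctional

variable {μ : Measure TemperedDistR}

lemma TemperedDistR.continuous_exp_apply (φ : SchwartzR) :
    Continuous fun ω : TemperedDistR ↦ Complex.exp (Complex.I * ((ω φ : ℝ) : ℂ)) := by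
  have : Continuous fun ω : TemperedDistR ↦ ω φ := WeakDual.eval_continuous φ
  exact Complex.continuous_exp.comp (continuous_const.mul (Complex.continuous_ofReal.comp this))

lemma norm_exp_I_mul_ofReal (x : ℝ) : ‖Complex.exp (Complex.I * (x : ℂ))‖ = 1 := by
  rw [mul_comm, Complex.norm_exp_ofReal_mul_I]

lemma TemperedDistR.integrable_exp_apply [IsFiniteMeasure μ] (φ : SchwartzR) :
    Integrable (fun ω : TemperedDistR ↦ Complex.exp (Complex.I * ((ω φ : ℝ) : ℂ))) μ :=
  (integrable_const (1 : ℝ)).mono' (TemperedDistR.continuous_exp_apply φ).aestronglyMeasurable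
    (Filter.Eventually.of_forall fun _ ↦ (norm_exp_I_mul_ofReal _).le)

lemma TemperedDistR.continuous_integral_exp [IsFiniteMeasure μ] :
    Continuous fun φ : SchwartzR ↦
      ∫ ω : TemperedDistR, Complex.exp (Complex.I * ((ω φ : ℝ) : ℂ)) ∂μ := by
  refine continuous_of_dominated (bound := fun _ ↦ (1 : ℝ))
    (fun φ ↦ (TemperedDistR.continuous_exp_apply φ).aestronglyMeasurable)
    (fun φ ↦ Filter.Eventually.of_forall fun _ ↦ (norm_exp_I_mul_ofReal _).le)
    (integrable_const _) (Filter.Eventually.of_forall fun ω ↦ ?_)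
  have : Continuous fun φ : SchwartzR ↦ ω φ := map_continuous ω
  fun_prop

lemma TemperedDistR.isPosDefFun_integral_exp [IsFiniteMeasure μ] :
    IsPosDefFun fun φ : SchwartzR ↦
      ∫ ω : TemperedDistR, Complex.exp (Complex.I * ((ω φ : ℝ) : ℂ)) ∂μ := by
  intro n z φ
  have hpt : ∀ ω : TemperedDistR,
      ∑ j, ∑ l, z j * (starRingEnd ℂ) (z l) *
        Complex.exp (Complex.I * ((ω (φ j - φ l) : ℝ) : ℂ)) =
      ((‖∑ j, z j * Complex.exp (Complex.I * ((ω (φ j) : ℝ) : ℂ))‖ ^ 2 : ℝ) : ℂ) := by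
    intro ω
    push_cast
    rw [← Complex.mul_conj', map_sum, Finset.sum_mul_sum]
    refine Finset.sum_congr rfl fun j _ ↦ Finset.sum_congr rfl fun l _ ↦ ?_
    rw [map_mul, ← Complex.exp_conj, map_mul, Complex.conj_I, Complex.conj_ofReal, map_sub]
    push_cast
    rw [mul_sub, sub_eq_add_neg, Complex.exp_add, neg_mul]
    ring
  have hsum : ∑ j, ∑ l, z j * (starRingEnd ℂ) (z l) *
        ∫ ω : TemperedDistR, Complex.exp (Complex.I * ((ω (φ j - φ l) : ℝ) : ℂ)) ∂μ =
      ∫ ω : TemperedDistR,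
        ((‖∑ j, z j * Complex.exp (Complex.I * ((ω (φ j) : ℝ) : ℂ))‖ ^ 2 : ℝ) : ℂ) ∂μ := by
    simp_rw [← hpt]
    rw [integral_finsetSum _ fun j _ ↦ integrable_finsetSum _ fun l _ ↦
      (TemperedDistR.integrable_exp_apply _).const_mul _]
    refine Finset.sum_congr rfl fun j _ ↦ ?_
    rw [integral_finsetSum _ fun l _ ↦ (TemperedDistR.integrable_exp_apply _).const_mul _]
    exact Finset.sum_congr rfl fun l _ ↦ (integral_const_mul _ _).symm
  rw [hsum, integral_complex_ofReal]
  exact Complex.zero_le_real.2 (integral_nonneg fun _ ↦ by positivity)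

end CharacteristicFunctional

section Existence

open TopologicalSpace

variable {g : SchwartzR → ℂ}

/-- With high probability, the random functional is dominated by a Sobolev norm. -/
lemma SchwartzR.exists_measure_compl_dominatedSeq_enrich_le (hg : IsPosDefFun g)
    (hgc : Continuous g) (h0 : g 0 = 1) (d : ℕ → SchwartzR) (P : Measure (ℕ → ℝ))
    [IsProbabilityMeasure P]
    (hP : ∀ t : ℕ →₀ ℝ,
      ∫ a, Complex.exp (Complex.I * ((Finsupp.linearCombination ℝ a t : ℝ) : ℂ)) ∂P =
        g (Finsupp.linearCombination ℝ d t)) {η : ℝ} (hη : 0 < η) {ι : Type*} [Fintype ι]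
    (A : ι → SchwartzR →L[ℝ] SchwartzR) {K : ℝ} (hK : 0 ≤ K)
    (hest : ∀ φ, 1 - (g φ).re ≤ η / 6 + K * ‖SchwartzR.sobolevMap A φ‖ ^ 2) :
    ∃ R : ℝ, P (dominatedSeq (SchwartzR.sobolevMap (SchwartzR.enrich A)) R d)ᶜ ≤
      ENNReal.ofReal η := by
  set C : ℝ := Fintype.card ι * Real.pi
  have hC : 0 ≤ C := by positivity
  set R : ℝ := 6 * K * C / η + 1
  have hR : 1 ≤ R := by
    have : 0 ≤ 6 * K * C / η := by positivity
    simp only [R]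
    linarith
  have hRbound : 3 * (η / 6 + K / R ^ 2 * C) ≤ η := by
    have h1 : 6 * K * C ≤ η * R := by
      simp only [R]
      field_simp
      linarith
    have h2 : η * R ≤ η * R ^ 2 := by gcongr; nlinarith
    have h3 : K / R ^ 2 * C ≤ η / 6 := by
      rw [div_mul_eq_mul_div, div_le_iff₀ (by positivity)]
      linarith
    linarith
  refine ⟨R, ?_⟩
  set Λ := SchwartzR.sobolevMap (SchwartzR.enrich A)
  let B : ℕ → Set (ℕ → ℝ) := fun n ↦ {a | ∃ t : ℕ →₀ ℝ, t.support ⊆ Finset.range n ∧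
    R * ‖Λ (Finsupp.linearCombination ℝ d t)‖ < |Finsupp.linearCombination ℝ a t|}
  have hB : (dominatedSeq Λ R d)ᶜ ⊆ ⋃ n, B n := by
    intro a ha
    have ha : ¬ ∀ t : ℕ →₀ ℝ, |Finsupp.linearCombination ℝ a t| ≤
      R * ‖Λ (Finsupp.linearCombination ℝ d t)‖ := ha
    push Not at ha
    obtain ⟨t, ht⟩ := ha
    obtain ⟨n, hn⟩ := t.support.exists_nat_subset_range
    exact Set.mem_iUnion.2 ⟨n, t, hn, ht⟩
  have hmono : Monotone B := by
    rintro m n hmn a ⟨t, ht, h⟩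
    exact ⟨t, ht.trans (Finset.range_subset_range.2 hmn), h⟩
  refine (measure_mono hB).trans ?_
  rw [hmono.measure_iUnion]
  refine iSup_le fun n ↦ ?_
  let Λp : SchwartzR →ₗ[ℝ] PiLp 2 fun _ : ι ↦ Lp ℝ 2 (volume : Measure ℝ) :=
    SchwartzR.sobolevMap A
  let Λq : SchwartzR →ₗ[ℝ] PiLp 2 fun _ : Option (ι × Fin 4) ↦ Lp ℝ 2 (volume : Measure ℝ) := Λ
  have hinj : Function.Injective Λq := SchwartzR.injective_sobolevMap_enrich A
  have hHS : ∀ (m : ℕ) (e : Fin m → SchwartzR), Orthonormal ℝ (Λq ∘ e) →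
      ∑ i, ‖Λp (e i)‖ ^ 2 ≤ C := SchwartzR.sum_norm_sobolevMap_sq_le A
  have h := hg.measure_exists_lt_abs_le hgc h0 Λp Λq hinj hHS hK hest
    (zero_lt_one.trans_le hR) d P hP n
  exact h.trans (ENNReal.ofReal_le_ofReal hRbound)

lemma SchwartzR.exists_measure_compl_dominatedSeq_le (hg : IsPosDefFun g) (hgc : Continuous g)
    (h0 : g 0 = 1) (d : ℕ → SchwartzR) (P : Measure (ℕ → ℝ)) [IsProbabilityMeasure P]
    (hP : ∀ t : ℕ →₀ ℝ,
      ∫ a, Complex.exp (Complex.I * ((Finsupp.linearCombination ℝ a t : ℝ) : ℂ)) ∂P =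
        g (Finsupp.linearCombination ℝ d t)) {η : ℝ} (hη : 0 < η) :
    ∃ (s : Finset (ℕ × ℕ)) (R : ℝ), P (dominatedSeq (SchwartzR.sobolevMap (SchwartzR.enrich
      fun j : s × Bool ↦ SchwartzR.weightedDeriv j.1 j.2)) R d)ᶜ ≤ ENNReal.ofReal η := by
  obtain ⟨s, K, hK, hest⟩ := SchwartzR.exists_one_sub_re_le hgc h0 (hg.norm_le_one h0)
    (show 0 < η / 6 by positivity)
  exact ⟨s, SchwartzR.exists_measure_compl_dominatedSeq_enrich_le hg hgc h0 d P hP hη _ hK hest⟩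

/-- The existence half of the Bochner–Minlos theorem. -/
lemma IsPosDefFun.exists_measure_temperedDist (hg : IsPosDefFun g) (hgc : Continuous g)
    (h0 : g 0 = 1) : ∃ μ : Measure TemperedDistR, IsProbabilityMeasure μ ∧
      ∀ φ : SchwartzR, ∫ ω, Complex.exp (Complex.I * ((ω φ : ℝ) : ℂ)) ∂μ = g φ := by
  let d := denseSeq SchwartzR
  have hd : DenseRange d := denseRange_denseSeq SchwartzR
  obtain ⟨P, hPprob, hP⟩ := hg.exists_measure_nat hgc h0 d
  have hη : ∀ N : ℕ, (0 : ℝ) < 1 / ((N : ℝ) + 1) := fun N ↦ by positivity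
  choose s R hsR using fun N : ℕ ↦
    SchwartzR.exists_measure_compl_dominatedSeq_le hg hgc h0 d P hP (hη N)
  set D : ℕ → Set (ℕ → ℝ) := fun N ↦ dominatedSeq (SchwartzR.sobolevMap (SchwartzR.enrich
      fun j : s N × Bool ↦ SchwartzR.weightedDeriv j.1 j.2)) (R N) d
  have hae : ∀ᵐ a ∂P, a ∈ ⋃ N, D N := by
    rw [ae_iff]
    have hle : ∀ N : ℕ, P {a | a ∉ ⋃ N, D N} ≤ ENNReal.ofReal (1 / ((N : ℝ) + 1)) := fun N ↦
      (measure_mono fun a (ha : a ∉ ⋃ N, D N) (h : a ∈ D N) ↦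
        ha (Set.mem_iUnion.2 ⟨N, h⟩)).trans (hsR N)
    have hlim : Filter.Tendsto (fun N : ℕ ↦ ENNReal.ofReal (1 / ((N : ℝ) + 1))) Filter.atTop
        (nhds 0) := by
      simpa using ENNReal.tendsto_ofReal tendsto_one_div_add_atTop_nhds_zero_nat
    exact le_antisymm (ge_of_tendsto' hlim hle) zero_le
  have hT : AEMeasurable (functionalOfSeq d) P := by
    rw [← Measure.restrict_eq_self_of_ae_mem hae, aemeasurable_iUnion_iff]
    exact fun N ↦ (continuousOn_functionalOfSeq hd).aemeasurable isClosed_dominatedSeq.measurableSet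
  have hμ : IsProbabilityMeasure (P.map (functionalOfSeq d)) :=
    Measure.isProbabilityMeasure_map hT
  refine ⟨P.map (functionalOfSeq d), hμ, fun φ ↦ congrFun (hd.equalizer
    (TemperedDistR.continuous_integral_exp (μ := P.map (functionalOfSeq d))) hgc ?_) φ⟩
  funext k
  have hk := hP (Finsupp.single k 1)
  simp only [Finsupp.linearCombination_single, one_smul] at hk
  rw [Function.comp_apply, Function.comp_apply, ← hk,
    integral_map hT (TemperedDistR.continuous_exp_apply _).aestronglyMeasurable]
  refine integral_congr_ae ?_
  filter_upwards [hae] with a ha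
  obtain ⟨N, hN⟩ := Set.mem_iUnion.1 ha
  rw [functionalOfSeq_apply hN]

end Existence

/-- **Bochner–Minlos–Sazonov theorem.** A functional `g : 𝒮(ℝ) → ℂ` is the characteristic
functional of a probability measure on `𝒮'(ℝ)` if and only if `g 0 = 1`, `g` is continuous
(with respect to the Fréchet topology of `𝒮(ℝ)`), and `g` is positive definite. -/
theorem bochner_minlos_sazonov (g : SchwartzR → ℂ) :
    (∃ μ : Measure TemperedDistR, IsProbabilityMeasure μ ∧
        ∀ φ : SchwartzR,
          ∫ ω, Complex.exp (Complex.I * ((ω φ : ℝ) : ℂ)) ∂μ = g φ) ↔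
      (g 0 = 1 ∧ Continuous g ∧
        ∀ (n : ℕ) (z : Fin n → ℂ) (φ : Fin n → SchwartzR),
          0 ≤ ∑ j, ∑ l, z j * (starRingEnd ℂ) (z l) * g (φ j - φ l)) := by
  constructor
  · rintro ⟨μ, hμ, h⟩
    obtain rfl : (fun φ ↦ ∫ ω, Complex.exp (Complex.I * ((ω φ : ℝ) : ℂ)) ∂μ) = g := funext h
    exact ⟨by simp, TemperedDistR.continuous_integral_exp, TemperedDistR.isPosDefFun_integral_exp⟩
  · rintro ⟨h0, hgc, hg⟩
    exact IsPosDefFun.exists_measure_temperedDist hg hgc h0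

end
end

section
/- The Gaussian functional is positive definite on L²(ℝ): for every n ∈ ℕ, all z₁,…,zₙ ∈ ℂ and all φ₁,…,φₙ ∈ L²(ℝ), the sum Σ_{j,ℓ=1}^n z_j·conj(z_ℓ)·exp(−½‖φ_j − φ_ℓ‖²_{L²(ℝ)}) is a nonnegative real number. -/
open MeasureTheory
open scoped ComplexOrder

noncomputable section

open scoped Matrix MatrixOrder

theorem Matrix.PosSemidef.map_ofReal {ι : Type*} [Fintype ι] {A : Matrix ι ι ℝ}
    (hA : A.PosSemidef) : (A.map Complex.ofReal).PosSemidef := by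
  classical
  obtain ⟨B, rfl⟩ := CStarAlgebra.nonneg_iff_eq_star_mul_self.mp hA.nonneg
  have h : (star B * B).map Complex.ofReal =
      (B.map Complex.ofReal)ᴴ * B.map Complex.ofReal := by
    ext i j
    simp [Matrix.mul_apply, Matrix.star_apply]
  rw [h]
  exact Matrix.posSemidef_conjTranspose_mul_self _

theorem Matrix.PosSemidef.map_pow {ι : Type*} {A : Matrix ι ι ℂ}
    (hA : A.PosSemidef) (k : ℕ) : (A.map (· ^ k)).PosSemidef := by
  induction k with
  | zero =>
    refine ⟨by ext; simp, fun x ↦ ?_⟩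
    have h : (x.sum fun i xi ↦ x.sum fun j xj ↦ star xi * A.map (· ^ 0) i j * xj) =
        star (∑ i ∈ x.support, x i) * ∑ i ∈ x.support, x i := by
      simp [Finsupp.sum, Finset.sum_mul_sum]
    rw [h]
    exact star_mul_self_nonneg _
  | succ k ih =>
    have h : A.map (· ^ (k + 1)) = A.map (· ^ k) ⊙ A := by
      ext i j
      simp [pow_succ]
    rw [h]
    exact ih.hadamard hA

/-- The entrywise exponential of a positive semidefinite matrix is positive semidefinite. -/
theorem Matrix.PosSemidef.map_exp {ι : Type*} [Fintype ι] {A : Matrix ι ι ℂ}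
    (hA : A.PosSemidef) : (A.map Complex.exp).PosSemidef := by
  refine .of_dotProduct_mulVec_nonneg ?_ fun x ↦ ?_
  · ext i j
    simp only [Matrix.conjTranspose_apply, Matrix.map_apply, RCLike.star_def, ← Complex.exp_conj]
    rw [← hA.isHermitian.apply i j, RCLike.star_def]
  · have hexp (w : ℂ) : HasSum (fun k : ℕ ↦ w ^ k / (k.factorial : ℂ)) (Complex.exp w) := by
      rw [Complex.exp_eq_exp_ℂ]
      exact NormedSpace.expSeries_div_hasSum_exp w
    have hsum : HasSum (fun k : ℕ ↦ ∑ i, ∑ j, star (x i) * (A i j ^ k / (k.factorial : ℂ) * x j))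
        (∑ i, ∑ j, star (x i) * (Complex.exp (A i j) * x j)) :=
      hasSum_sum fun i _ ↦ hasSum_sum fun j _ ↦ ((hexp (A i j)).mul_right (x j)).mul_left _
    have hgoal : star x ⬝ᵥ A.map Complex.exp *ᵥ x =
        ∑ i, ∑ j, star (x i) * (Complex.exp (A i j) * x j) := by
      simp [dotProduct, Matrix.mulVec, Finset.mul_sum]
    rw [hgoal]
    refine hsum.nonneg fun k ↦ ?_
    have hk : ∑ i, ∑ j, star (x i) * (A i j ^ k / (k.factorial : ℂ) * x j) =
        (k.factorial : ℂ)⁻¹ * (star x ⬝ᵥ A.map (· ^ k) *ᵥ x) := by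
      simp only [dotProduct, Matrix.mulVec, Finset.mul_sum, Matrix.map_apply, Pi.star_apply]
      refine Finset.sum_congr rfl fun i _ ↦ Finset.sum_congr rfl fun j _ ↦ ?_
      ring
    rw [hk]
    refine mul_nonneg ?_ ((hA.map_pow k).dotProduct_mulVec_nonneg x)
    exact inv_nonneg.mpr (Nat.cast_nonneg _)

/-- The Gaussian functional `φ ↦ exp(−½‖φ‖²)` is positive definite on `L²(ℝ)`:
for all `z₁,…,zₙ ∈ ℂ` and `φ₁,…,φₙ ∈ L²(ℝ)`, the sum
`Σ_{j,ℓ} z_j conj(z_ℓ) exp(−½‖φ_j − φ_ℓ‖²)` is a nonnegative real number. -/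
theorem gaussian_functional_positive_definite
    (n : ℕ) (z : Fin n → ℂ) (φ : Fin n → Lp ℝ 2 (volume : Measure ℝ)) :
    0 ≤ ∑ j, ∑ l, z j * (starRingEnd ℂ) (z l) *
        ((Real.exp (-(1/2) * ‖φ j - φ l‖^2) : ℝ) : ℂ) := by
  have h := (Matrix.posSemidef_gram ℝ φ).map_ofReal.map_exp.dotProduct_mulVec_nonneg
    fun j ↦ (Real.exp (-(1/2) * ‖φ j‖^2) : ℂ) * star (z j)
  convert h using 1
  simp only [dotProduct, Matrix.mulVec, Finset.mul_sum, Matrix.map_apply, Matrix.gram_apply,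
    Pi.star_apply]
  refine Finset.sum_congr rfl fun j _ ↦ Finset.sum_congr rfl fun l _ ↦ ?_
  have hexp : Real.exp (-(1/2) * ‖φ j - φ l‖^2) = Real.exp (-(1/2) * ‖φ j‖^2) *
      Real.exp (inner ℝ (φ j) (φ l)) * Real.exp (-(1/2) * ‖φ l‖^2) := by
    rw [← Real.exp_add, ← Real.exp_add, norm_sub_sq_real]
    ring_nf
  rw [hexp, ← Complex.ofReal_exp (inner ℝ (φ j) (φ l))]
  simp only [star_mul', RCLike.star_def, Complex.conj_conj, Complex.conj_ofReal, Complex.ofReal_mul]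
  ring

end
end

section
/- (Existence of the white noise probability measure.) There exists a probability measure P on 𝒮'(ℝ) (with the Borel σ-algebra of the weak-* topology) such that ∫_{𝒮'(ℝ)} e^{i⟨ω,φ⟩} dP(ω) = e^{−‖φ‖²/2} for all φ ∈ 𝒮(ℝ), where ‖φ‖ is the L²(ℝ)-norm of φ. -/
open MeasureTheory

noncomputable section

open ProbabilityTheory Filter Topology

/-- Almost every sequence of independent standard Gaussians is bounded after multiplication by
summable weights. -/
theorem ae_exists_forall_mul_abs_le {ι : Type*} [Countable ι] {C : ι → ℝ}
    (hC0 : ∀ i, 0 < C i) (hC : Summable C) :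
    ∀ᵐ ξ ∂Measure.infinitePi (fun _ : ι => gaussianReal 0 1),
      ∃ N : ℕ, ∀ i, C i * |ξ i| ≤ N := by
  set μ := Measure.infinitePi (fun _ : ι => gaussianReal 0 1)
  have hmeas : ∀ i, Measurable fun ξ : ι → ℝ => ENNReal.ofReal (C i * |ξ i|) := fun i => by
    fun_prop
  have hint : ∀ i, ∫⁻ ξ, ENNReal.ofReal (C i * |ξ i|) ∂μ
      = ENNReal.ofReal (C i) * ∫⁻ x, ENNReal.ofReal |x| ∂gaussianReal 0 1 := fun i => by
    have h := (measurePreserving_eval_infinitePi (fun _ : ι => gaussianReal 0 1) i).lintegral_comp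
      (f := fun x => ENNReal.ofReal (C i * |x|)) (by fun_prop)
    rw [show (∫⁻ ξ, ENNReal.ofReal (C i * |ξ i|) ∂μ) = _ from h,
      ← lintegral_const_mul _ (by fun_prop)]
    simp_rw [ENNReal.ofReal_mul (hC0 i).le]
  have hfin : ∫⁻ x, ENNReal.ofReal |x| ∂gaussianReal 0 1 ≠ ⊤ := by
    have h : Integrable id (gaussianReal 0 1) := memLp_one_iff_integrable.1 (memLp_id_gaussianReal 1)
    simpa [Real.enorm_eq_ofReal_abs] using h.2.ne
  have hsum : ∫⁻ ξ, ∑' i, ENNReal.ofReal (C i * |ξ i|) ∂μ ≠ ⊤ := by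
    rw [lintegral_tsum fun i => (hmeas i).aemeasurable]
    simp_rw [hint]
    rw [ENNReal.tsum_mul_right, ← ENNReal.ofReal_tsum_of_nonneg (fun i => (hC0 i).le) hC]
    exact ENNReal.mul_ne_top ENNReal.ofReal_ne_top hfin
  filter_upwards [ae_lt_top (Measurable.tsum hmeas) hsum] with ξ hξ
  obtain ⟨N, hN⟩ := ENNReal.exists_nat_gt hξ.ne
  refine ⟨N, fun i => ?_⟩
  have := (ENNReal.le_tsum i).trans hN.le
  rwa [ENNReal.ofReal_le_natCast] at this

/-- The characteristic function of a finite combination of independent standard Gaussians. -/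
theorem integral_exp_sum_infinitePi_gaussianReal {ι : Type*} (s : Finset ι) (a : ι → ℝ) :
    ∫ ξ, Complex.exp (Complex.I * ((∑ i ∈ s, ξ i * a i : ℝ) : ℂ))
        ∂Measure.infinitePi (fun _ : ι => gaussianReal 0 1)
      = Complex.exp (-(1/2) * ((∑ i ∈ s, a i ^ 2 : ℝ) : ℂ)) := by
  have h1 : ∀ t : ℝ, ∫ x, Complex.exp (Complex.I * ((x * t : ℝ) : ℂ)) ∂gaussianReal 0 1
      = Complex.exp (-(1/2) * ((t ^ 2 : ℝ) : ℂ)) := fun t => by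
    have h := charFun_gaussianReal (μ := 0) (v := 1) t
    rw [charFun_apply_real] at h
    convert h using 2
    · ext x; congr 1; push_cast; ring
    · push_cast; ring
  have h2 := integral_restrict_infinitePi (μ := fun _ : ι => gaussianReal 0 1) (s := s)
    (f := fun y => ∏ i : s, Complex.exp (Complex.I * ((y i * a i : ℝ) : ℂ)))
    (Continuous.aestronglyMeasurable (by fun_prop))
  rw [integral_fintype_prod_eq_prod (f := fun (i : s) (x : ℝ) =>
    Complex.exp (Complex.I * ((x * a i : ℝ) : ℂ)))] at h2
  simp_rw [h1, ← Complex.exp_sum, ← Finset.mul_sum, ← Complex.ofReal_sum] at h2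
  rw [Finset.sum_coe_sort s fun i => a i ^ 2] at h2
  rw [← h2]
  congr 1
  ext ξ
  simp only [Finset.restrict]
  rw [Finset.sum_coe_sort s fun i => ξ i * a i]

section RandomSeries

variable {E : Type*} [AddCommGroup E] [Module ℝ E] {ι : Type*}

/-- A random series of functionals with rapidly decreasing coefficients converges absolutely. -/
theorem summable_mul_of_mul_abs_le {a : ι → E →ₗ[ℝ] ℝ} {p : Seminorm ℝ E} {C : ι → ℝ}
    (hC0 : ∀ i, 0 < C i) (hC : Summable C) (ha : ∀ i x, |a i x| ≤ C i ^ 2 * p x)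
    {ξ : ι → ℝ} {N : ℕ} (hξ : ∀ i, C i * |ξ i| ≤ N) (x : E) :
    (∀ i, ‖ξ i * a i x‖ ≤ C i * (N * p x)) ∧ Summable fun i => ξ i * a i x := by
  have key : ∀ i, ‖ξ i * a i x‖ ≤ C i * (N * p x) := fun i => by
    rw [Real.norm_eq_abs, abs_mul]
    calc |ξ i| * |a i x| ≤ |ξ i| * (C i ^ 2 * p x) := by gcongr; exact ha i x
      _ = C i * ((C i * |ξ i|) * p x) := by ring
      _ ≤ _ := by gcongr; exacts [(hC0 i).le, hξ i]
  exact ⟨key, .of_norm_bounded (hC.mul_right _) key⟩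

variable [TopologicalSpace E]

/-- The sum of a series of functionals with rapidly decreasing coefficients, as an element of the
weak dual. -/
theorem exists_weakDual_apply_eq_tsum [IsTopologicalAddGroup E] [ContinuousSMul ℝ E]
    {a : ι → E →ₗ[ℝ] ℝ} {p : Seminorm ℝ E} (hp : Continuous p) {C : ι → ℝ}
    (hC0 : ∀ i, 0 < C i) (hC : Summable C) (ha : ∀ i x, |a i x| ≤ C i ^ 2 * p x)
    {ξ : ι → ℝ} {N : ℕ} (hξ : ∀ i, C i * |ξ i| ≤ N) :
    ∃ ω : WeakDual ℝ E, ∀ x, ω x = ∑' i, ξ i * a i x := by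
  have hs := summable_mul_of_mul_abs_le hC0 hC ha hξ
  let L : E →ₗ[ℝ] ℝ :=
    { toFun := fun x => ∑' i, ξ i * a i x
      map_add' := fun x y => by
        rw [← (hs x).2.tsum_add (hs y).2]
        simp [mul_add]
      map_smul' := fun c x => by
        rw [RingHom.id_apply, smul_eq_mul, ← tsum_mul_left]
        simp [mul_left_comm] }
  have hL : ∀ x, ‖L x‖ ≤ (∑' i, C i) * (N * p x) := fun x => by
    rw [← tsum_mul_right]
    exact tsum_of_norm_bounded (hC.mul_right _).hasSum (hs x).1
  have hc : Continuous L := by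
    refine continuous_of_continuousAt_zero L ?_
    rw [ContinuousAt, map_zero]
    refine squeeze_zero_norm hL ?_
    have : Continuous fun x => (∑' i, C i) * (N * p x) := by fun_prop
    simpa using this.tendsto 0
  exact ⟨(⟨L, hc⟩ : E →L[ℝ] ℝ), fun x => rfl⟩

/-- Construction of a Gaussian measure on a weak dual from a rapidly decreasing family of
functionals. -/
theorem exists_gaussian_measure_weakDual [IsTopologicalAddGroup E] [ContinuousSMul ℝ E]
    [MeasurableSpace (WeakDual ℝ E)] [BorelSpace (WeakDual ℝ E)] [Countable ι]
    {a : ι → E →ₗ[ℝ] ℝ} {p : Seminorm ℝ E} (hp : Continuous p) {C : ι → ℝ}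
    (hC0 : ∀ i, 0 < C i) (hC : Summable C) (ha : ∀ i x, |a i x| ≤ C i ^ 2 * p x)
    {q : E → ℝ} (hq : ∀ x, HasSum (fun i => a i x ^ 2) (q x)) :
    ∃ P : Measure (WeakDual ℝ E), IsProbabilityMeasure P ∧
      ∀ x, ∫ ω, Complex.exp (Complex.I * ((ω x : ℝ) : ℂ)) ∂P
        = Complex.exp (-(1/2) * (q x : ℂ)) := by
  classical
  set μ := Measure.infinitePi (fun _ : ι => gaussianReal 0 1) with hμ
  let S : ℕ → Set (ι → ℝ) := fun N => {ξ | ∀ i, C i * |ξ i| ≤ N}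
  have hS : ∀ N, MeasurableSet (S N) := fun N => by
    refine IsClosed.measurableSet ?_
    simp only [S, Set.ofPred_forall]
    exact isClosed_iInter fun i => isClosed_le (by fun_prop) continuous_const
  have hae : ∀ᵐ ξ ∂μ, ∃ N, ξ ∈ S N := ae_exists_forall_mul_abs_le hC0 hC
  have hex : ∀ ξ : ι → ℝ, ∃ ω : WeakDual ℝ E, ∀ N, ξ ∈ S N → ∀ x, ω x = ∑' i, ξ i * a i x := by
    intro ξ
    by_cases h : ∃ N, ξ ∈ S N
    · obtain ⟨N, hN⟩ := h
      obtain ⟨ω, hω⟩ := exists_weakDual_apply_eq_tsum hp hC0 hC ha hN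
      exact ⟨ω, fun _ _ => hω⟩
    · exact ⟨0, fun N hN => (h ⟨N, hN⟩).elim⟩
  choose Φ hΦ using hex
  have hcont : ∀ N, ContinuousOn Φ (S N) := fun N => by
    rw [continuousOn_iff_continuous_domRestrict]
    refine WeakDual.continuous_of_continuous_eval fun x => ?_
    have : ContinuousOn (fun ξ : ι → ℝ => ∑' i, ξ i * a i x) (S N) :=
      continuousOn_tsum (fun i => by fun_prop) (hC.mul_right (N * p x))
        fun i ξ hξ => (summable_mul_of_mul_abs_le hC0 hC ha hξ x).1 i
    rw [continuousOn_iff_continuous_domRestrict] at this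
    exact this.congr fun ξ => (hΦ ξ N ξ.2 x).symm
  have hmeas : AEMeasurable Φ μ := by
    have h : AEMeasurable Φ (μ.restrict (⋃ N, S N)) :=
      aemeasurable_iUnion_iff.2 fun N => (hcont N).aemeasurable (hS N)
    rwa [Measure.restrict_eq_self_of_ae_mem] at h
    filter_upwards [hae] with ξ hξ using Set.mem_iUnion.2 hξ
  refine ⟨μ.map Φ, Measure.isProbabilityMeasure_map hmeas, fun x => ?_⟩
  have heval : Continuous fun ω : WeakDual ℝ E => Complex.exp (Complex.I * ((ω x : ℝ) : ℂ)) := by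
    have h : Continuous fun ω : WeakDual ℝ E => ω x := WeakDual.eval_continuous x
    exact Complex.continuous_exp.comp
      (continuous_const.mul (Complex.continuous_ofReal.comp h))
  rw [integral_map hmeas heval.aestronglyMeasurable]
  have hlim : Tendsto (fun s : Finset ι => ∫ ξ, Complex.exp
      (Complex.I * ((∑ i ∈ s, ξ i * a i x : ℝ) : ℂ)) ∂μ) atTop
      (𝓝 (∫ ξ, Complex.exp (Complex.I * ((Φ ξ x : ℝ) : ℂ)) ∂μ)) := by
    refine tendsto_integral_filter_of_dominated_convergence (fun _ => 1)
      (.of_forall fun s => Continuous.aestronglyMeasurable (by fun_prop))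
      (.of_forall fun s => .of_forall fun ξ => ?_) (integrable_const _) ?_
    · rw [mul_comm, Complex.norm_exp_ofReal_mul_I]
    · filter_upwards [hae] with ξ ⟨N, hN⟩
      have h : Tendsto (fun s : Finset ι => ∑ i ∈ s, ξ i * a i x) atTop (𝓝 (Φ ξ x)) := by
        rw [hΦ ξ N hN x]
        exact (summable_mul_of_mul_abs_le hC0 hC ha hN x).2.hasSum
      have hc : Continuous fun t : ℝ => Complex.exp (Complex.I * (t : ℂ)) := by fun_prop
      exact (hc.tendsto _).comp h
  simp_rw [hμ, integral_exp_sum_infinitePi_gaussianReal] at hlim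
  have hc : Continuous fun t : ℝ => Complex.exp (-(1/2) * (t : ℂ)) := by fun_prop
  exact tendsto_nhds_unique hlim ((hc.tendsto _).comp (hq x))

end RandomSeries

/-- The rational character `x ↦ ((1 + i x) / (1 - i x)) ^ n` of the real line. -/
def cayleyChar (n : ℤ) (x : ℝ) : ℂ :=
  Complex.exp (((2 * n * Real.arctan x : ℝ) : ℂ) * Complex.I)

theorem norm_cayleyChar (n : ℤ) (x : ℝ) : ‖cayleyChar n x‖ = 1 :=
  Complex.norm_exp_ofReal_mul_I _

theorem continuous_cayleyChar (n : ℤ) : Continuous (cayleyChar n) := by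
  have := Real.continuous_arctan
  unfold cayleyChar
  fun_prop

theorem conj_cayleyChar (n : ℤ) (x : ℝ) :
    (starRingEnd ℂ) (cayleyChar n x) = cayleyChar (-n) x := by
  rw [cayleyChar, cayleyChar, ← Complex.exp_conj, map_mul, Complex.conj_ofReal, Complex.conj_I]
  push_cast
  ring_nf

theorem hasDerivAt_cayleyChar (n : ℤ) (x : ℝ) :
    HasDerivAt (cayleyChar n)
      (2 * n * Complex.I * (((1 + x ^ 2 : ℝ) : ℂ)⁻¹ * cayleyChar n x)) x := by
  have h := ((((Real.hasDerivAt_arctan x).const_mul (2 * n : ℝ)).ofReal_comp).mul_const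
    Complex.I).cexp
  refine h.congr_deriv ?_
  simp only [cayleyChar]
  push_cast
  ring

theorem integrable_mul_cayleyChar (g : SchwartzR) (n : ℤ) :
    Integrable fun x => (g x : ℂ) * cayleyChar n x :=
  g.integrable.ofReal.mul_bdd (c := 1) (continuous_cayleyChar n).aestronglyMeasurable
    (.of_forall fun x => (norm_cayleyChar n x).le)

/-- The pairing of a Schwartz function with a rational character. -/
def cayleyCoeff (n : ℤ) : SchwartzR →ₗ[ℝ] ℂ where
  toFun g := ∫ x, (g x : ℂ) * cayleyChar n x
  map_add' f g := by
    rw [← integral_add (integrable_mul_cayleyChar f n) (integrable_mul_cayleyChar g n)]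
    simp [add_mul]
  map_smul' c g := by
    rw [RingHom.id_apply, ← integral_smul]
    simp [mul_assoc]

theorem cayleyCoeff_apply (n : ℤ) (g : SchwartzR) :
    cayleyCoeff n g = ∫ x, (g x : ℂ) * cayleyChar n x := rfl

theorem conj_cayleyCoeff (n : ℤ) (g : SchwartzR) :
    (starRingEnd ℂ) (cayleyCoeff n g) = cayleyCoeff (-n) g := by
  rw [cayleyCoeff_apply, cayleyCoeff_apply, ← integral_conj]
  refine integral_congr_ae (.of_forall fun x => ?_)
  simp only [map_mul, Complex.conj_ofReal, conj_cayleyChar]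

theorem norm_cayleyCoeff_le (n : ℤ) (g : SchwartzR) :
    ‖cayleyCoeff n g‖ ≤ ‖SchwartzMap.toLpCLM ℝ ℝ 1 volume g‖ := by
  rw [SchwartzMap.toLpCLM_apply, SchwartzMap.norm_toLp_one, cayleyCoeff_apply]
  refine (norm_integral_le_integral_norm _).trans_eq ?_
  simp [norm_cayleyChar]

theorem hasTemperateGrowth_one_add_sq :
    (fun x : ℝ => 1 + x ^ 2).HasTemperateGrowth := by
  fun_prop

/-- The operator `g ↦ ((1 + x²) g)'`, whose transpose is diagonal on rational characters. -/
def cayleyDeriv : SchwartzR →L[ℝ] SchwartzR :=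
  (SchwartzMap.derivCLM ℝ ℝ).comp (SchwartzMap.smulLeftCLM ℝ fun x : ℝ => 1 + x ^ 2)

theorem cayleyCoeff_cayleyDeriv (n : ℤ) (g : SchwartzR) :
    cayleyCoeff n (cayleyDeriv g) = -(2 * n * Complex.I) * cayleyCoeff n g := by
  set h : SchwartzR := SchwartzMap.smulLeftCLM ℝ (fun x : ℝ => 1 + x ^ 2) g
  have hh : ∀ x, h x = (1 + x ^ 2) * g x := fun x => by
    simp [h, SchwartzMap.smulLeftCLM_apply_apply hasTemperateGrowth_one_add_sq]
  have hd : ∀ x, cayleyDeriv g x = deriv h x := fun x => by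
    simp [cayleyDeriv, SchwartzMap.derivCLM_apply, h]
  have hpt : ∀ x, (h x : ℂ) * (2 * n * Complex.I * (((1 + x ^ 2 : ℝ) : ℂ)⁻¹ * cayleyChar n x))
      = 2 * n * Complex.I * ((g x : ℂ) * cayleyChar n x) := fun x => by
    have : ((1 + x ^ 2 : ℝ) : ℂ) ≠ 0 := by
      exact_mod_cast (by positivity : (1 + x ^ 2 : ℝ) ≠ 0)
    rw [hh, Complex.ofReal_mul]
    field_simp
  have hu : ∀ x, HasDerivAt (fun y => (h y : ℂ)) ((cayleyDeriv g x : ℝ) : ℂ) x := fun x => by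
    rw [hd]
    exact (h.differentiableAt.hasDerivAt).ofReal_comp
  have key := integral_mul_deriv_eq_deriv_mul_of_integrable
    (u := fun x => (h x : ℂ)) (v := cayleyChar n)
    (u' := fun x => (cayleyDeriv g x : ℂ))
    (fun x _ => hu x) (fun x _ => hasDerivAt_cayleyChar n x)
    (by
      refine Integrable.congr ((integrable_mul_cayleyChar g n).const_mul (2 * n * Complex.I)) ?_
      exact .of_forall fun x => (hpt x).symm)
    (integrable_mul_cayleyChar _ n) (integrable_mul_cayleyChar _ n)
  simp_rw [hpt] at key
  rw [integral_const_mul] at key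
  rw [cayleyCoeff_apply, cayleyCoeff_apply, neg_mul, key, neg_neg]

/-- An operator whose transpose multiplies the `n`-th rational character by `(1 + 4 n²)²`. -/
def cayleyElliptic : SchwartzR →L[ℝ] SchwartzR :=
  (ContinuousLinearMap.id ℝ _ - cayleyDeriv ∘L cayleyDeriv) ∘L
    (ContinuousLinearMap.id ℝ _ - cayleyDeriv ∘L cayleyDeriv)

theorem cayleyCoeff_cayleyElliptic (n : ℤ) (g : SchwartzR) :
    cayleyCoeff n (cayleyElliptic g) = ((1 + 4 * n ^ 2 : ℝ) : ℂ) ^ 2 * cayleyCoeff n g := by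
  have h : ∀ f : SchwartzR, cayleyCoeff n (f - cayleyDeriv (cayleyDeriv f))
      = ((1 + 4 * n ^ 2 : ℝ) : ℂ) * cayleyCoeff n f := fun f => by
    rw [map_sub, cayleyCoeff_cayleyDeriv, cayleyCoeff_cayleyDeriv]
    push_cast
    linear_combination (-4 * n ^ 2 * cayleyCoeff n f) * Complex.I_sq
  have : cayleyElliptic g = (g - cayleyDeriv (cayleyDeriv g))
      - cayleyDeriv (cayleyDeriv (g - cayleyDeriv (cayleyDeriv g))) := rfl
  rw [this, h, h]
  ring

theorem norm_cayleyCoeff_le_inv_sq (n : ℤ) (g : SchwartzR) :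
    ‖cayleyCoeff n g‖ ≤
      ((1 + 4 * n ^ 2 : ℝ)⁻¹) ^ 2 * ‖SchwartzMap.toLpCLM ℝ ℝ 1 volume (cayleyElliptic g)‖ := by
  have hpos : (0 : ℝ) < 1 + 4 * n ^ 2 := by positivity
  have h := norm_cayleyCoeff_le n (cayleyElliptic g)
  rw [cayleyCoeff_cayleyElliptic, norm_mul, norm_pow, Complex.norm_real, Real.norm_eq_abs,
    abs_of_pos hpos] at h
  rw [inv_pow, ← div_eq_inv_mul, le_div_iff₀' (by positivity)]
  exact h

theorem summable_inv_one_add_four_mul_sq : Summable fun n : ℤ => (1 + 4 * (n : ℝ) ^ 2)⁻¹ := by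
  have h : Summable fun n : ℤ => 1 / (n : ℝ) ^ 2 := Real.summable_one_div_int_pow.2 (by norm_num)
  refine h.of_norm_bounded_eventually ?_
  filter_upwards [(Set.finite_singleton (0 : ℤ)).compl_mem_cofinite] with n hn
  have hn' : (0 : ℝ) < (n : ℝ) ^ 2 := by
    have : (n : ℝ) ≠ 0 := by simpa using hn
    positivity
  rw [Real.norm_of_nonneg (by positivity), one_div]
  gcongr
  linarith

/-- Multiplication by `(1 + x²)^(-1/2)` on the Schwartz space. -/
def cayleyWeight : SchwartzR →L[ℝ] SchwartzR :=
  SchwartzMap.smulLeftCLM ℝ fun x : ℝ => (1 + ‖x‖ ^ 2) ^ (-1 / 2 : ℝ)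

theorem cayleyWeight_apply (φ : SchwartzR) (x : ℝ) :
    cayleyWeight φ x = (√(1 + x ^ 2))⁻¹ * φ x := by
  rw [cayleyWeight, SchwartzMap.smulLeftCLM_apply_apply
    (Function.hasTemperateGrowth_one_add_norm_sq_rpow ℝ _), smul_eq_mul, Real.sqrt_eq_rpow,
    ← Real.rpow_neg (by positivity), Real.norm_eq_abs, sq_abs]
  norm_num

theorem integral_Ioo_comp_arctan {F : Type*} [NormedAddCommGroup F] [NormedSpace ℝ F]
    (G : ℝ → F) :
    ∫ θ in Set.Ioo (-(Real.pi / 2)) (Real.pi / 2), G θ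
      = ∫ x : ℝ, (1 + x ^ 2)⁻¹ • G (Real.arctan x) := by
  have h := integral_image_eq_integral_abs_deriv_smul (s := Set.univ) MeasurableSet.univ
    (fun x _ => (Real.hasDerivAt_arctan x).hasDerivWithinAt) Real.arctan_injective.injOn G
  rw [Set.image_univ, Real.range_arctan, setIntegral_univ] at h
  rw [h]
  refine integral_congr_ae (.of_forall fun x => ?_)
  simp only [one_div]
  rw [abs_of_pos (by positivity)]

theorem integrableOn_Ioo_iff_comp_arctan {F : Type*} [NormedAddCommGroup F] [NormedSpace ℝ F]
    (G : ℝ → F) :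
    IntegrableOn G (Set.Ioo (-(Real.pi / 2)) (Real.pi / 2))
      ↔ Integrable fun x : ℝ => (1 + x ^ 2)⁻¹ • G (Real.arctan x) := by
  have h := integrableOn_image_iff_integrableOn_abs_deriv_smul (s := Set.univ) MeasurableSet.univ
    (fun x _ => (Real.hasDerivAt_arctan x).hasDerivWithinAt) Real.arctan_injective.injOn G
  rw [Set.image_univ, Real.range_arctan, integrableOn_univ] at h
  rw [h]
  refine integrable_congr (.of_forall fun x => ?_)
  simp only [one_div]
  rw [abs_of_pos (by positivity)]

/-- **Parseval's identity** for the weighted rational characters. -/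
theorem hasSum_sq_norm_cayleyCoeff (φ : SchwartzR) :
    HasSum (fun n : ℤ => ‖cayleyCoeff n (cayleyWeight φ)‖ ^ 2 / Real.pi) (∫ x, φ x ^ 2) := by
  have hpi := Real.pi_pos
  have hab : -(Real.pi / 2) < Real.pi / 2 := by linarith
  have hba : Real.pi / 2 - -(Real.pi / 2) = Real.pi := by ring
  let ψ : ℝ → ℂ := fun θ => ((√(1 + Real.tan θ ^ 2) * φ (Real.tan θ) : ℝ) : ℂ)
  have hψ : ∀ x, ψ (Real.arctan x) = ((√(1 + x ^ 2) * φ x : ℝ) : ℂ) := fun x => by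
    simp only [ψ, Real.tan_arctan]
  have hsq : ∀ x : ℝ, (1 + x ^ 2)⁻¹ • ‖ψ (Real.arctan x)‖ ^ 2 = φ x ^ 2 := fun x => by
    have : (0 : ℝ) < 1 + x ^ 2 := by positivity
    rw [hψ, Complex.norm_real, Real.norm_eq_abs, sq_abs, mul_pow, Real.sq_sqrt this.le,
      smul_eq_mul, inv_mul_cancel_left₀ this.ne']
  have hmeas : Measurable ψ := by
    have h1 : Measurable Real.tan := by
      simp_rw [funext Real.tan_eq_sin_div_cos]
      fun_prop
    have h2 : Measurable φ := φ.continuous.measurable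
    fun_prop
  have hL2 : MemLp ψ 2 (volume.restrict (Set.Ioc (-(Real.pi / 2)) (Real.pi / 2))) := by
    rw [← Measure.restrict_congr_set Ioo_ae_eq_Ioc,
      memLp_two_iff_integrable_sq_norm hmeas.aestronglyMeasurable]
    refine (integrableOn_Ioo_iff_comp_arctan fun θ => ‖ψ θ‖ ^ 2).2 ?_
    simp_rw [hsq]
    exact (φ.memLp 2 volume).integrable_sq
  have hsum := hasSum_sq_fourierCoeffOn hab hL2
  have hcoeff : ∀ n, fourierCoeffOn hab ψ n
      = (1 / Real.pi) • cayleyCoeff (-n) (cayleyWeight φ) := fun n => by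
    rw [fourierCoeffOn_eq_integral, hba, intervalIntegral.integral_of_le hab.le,
      integral_Ioc_eq_integral_Ioo, integral_Ioo_comp_arctan, cayleyCoeff_apply]
    congr 1
    refine integral_congr_ae (.of_forall fun x => ?_)
    have : (0 : ℝ) < 1 + x ^ 2 := by positivity
    have hw : (1 + x ^ 2)⁻¹ * √(1 + x ^ 2) = (√(1 + x ^ 2))⁻¹ := by
      rw [← div_eq_inv_mul, Real.sqrt_div_self']; simp
    have hc : (fourier (-n) (Real.arctan x : AddCircle Real.pi) : ℂ) = cayleyChar (-n) x := by
      rw [fourier_coe_apply, cayleyChar]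
      congr 1
      push_cast
      field_simp
    simp only [hc, hψ, cayleyWeight_apply]
    rw [← hw, smul_eq_mul, Complex.real_smul]
    push_cast
    ring
  rw [intervalIntegral.integral_of_le hab.le, integral_Ioc_eq_integral_Ioo,
    integral_Ioo_comp_arctan, hba] at hsum
  simp_rw [hsq, hcoeff] at hsum
  have h2 := hsum.mul_left Real.pi
  rw [smul_eq_mul, mul_inv_cancel_left₀ hpi.ne'] at h2
  rw [← (Equiv.neg ℤ).hasSum_iff]
  refine h2.congr_fun fun n => ?_
  simp only [Function.comp, Equiv.neg_apply, norm_smul, Real.norm_eq_abs]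
  rw [abs_of_pos (by positivity)]
  field_simp

theorem re_add_im_sq (z : ℂ) : (z.re + z.im) ^ 2 = ‖z‖ ^ 2 + 2 * (z.re * z.im) := by
  rw [Complex.sq_norm, Complex.normSq_apply]
  ring

/-- The real functionals obtained by pairing with `cos + sin` of the Cayley angle; they form a
Parseval frame. -/
def hartleyCoeff (n : ℤ) : SchwartzR →ₗ[ℝ] ℝ :=
  (√Real.pi)⁻¹ • ((Complex.reLm + Complex.imLm) ∘ₗ cayleyCoeff n ∘ₗ
    (cayleyWeight : SchwartzR →ₗ[ℝ] SchwartzR))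

theorem hartleyCoeff_apply (n : ℤ) (φ : SchwartzR) :
    hartleyCoeff n φ = (√Real.pi)⁻¹ *
      ((cayleyCoeff n (cayleyWeight φ)).re + (cayleyCoeff n (cayleyWeight φ)).im) := rfl

theorem hasSum_sq_hartleyCoeff (φ : SchwartzR) :
    HasSum (fun n : ℤ => hartleyCoeff n φ ^ 2) (∫ x, φ x ^ 2) := by
  have hpi := Real.pi_pos
  have h := hasSum_sq_norm_cayleyCoeff φ
  set c : ℤ → ℂ := fun n => cayleyCoeff n (cayleyWeight φ)
  let r : ℤ → ℝ := fun n => 2 * ((c n).re * (c n).im) / Real.pi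
  have hodd : ∀ n, r (-n) = -r n := fun n => by
    simp only [r, c, ← conj_cayleyCoeff, Complex.conj_re, Complex.conj_im]
    ring
  have hr : Summable r := by
    refine .of_norm_bounded h.summable fun n => ?_
    rw [Real.norm_eq_abs, abs_div, abs_of_pos hpi]
    gcongr
    change |2 * ((c n).re * (c n).im)| ≤ ‖c n‖ ^ 2
    rw [Complex.sq_norm, Complex.normSq_apply, abs_le]
    constructor <;> nlinarith [sq_nonneg ((c n).re + (c n).im), sq_nonneg ((c n).re - (c n).im)]
  have hr0 : HasSum r 0 := by
    have h1 := (Equiv.neg ℤ).tsum_eq r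
    simp only [Equiv.neg_apply, hodd, tsum_neg] at h1
    have : ∑' n, r n = 0 := by linarith
    exact this ▸ hr.hasSum
  have := h.add hr0
  rw [add_zero] at this
  refine this.congr_fun fun n => ?_
  rw [hartleyCoeff_apply, mul_pow, re_add_im_sq, inv_pow, Real.sq_sqrt hpi.le]
  simp only [r, c]
  ring

theorem abs_hartleyCoeff_le (n : ℤ) (φ : SchwartzR) :
    |hartleyCoeff n φ| ≤ ((1 + 4 * n ^ 2 : ℝ)⁻¹) ^ 2 *
      (2 * ‖SchwartzMap.toLpCLM ℝ ℝ 1 volume (cayleyElliptic (cayleyWeight φ))‖) := by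
  set z := cayleyCoeff n (cayleyWeight φ) with hz
  have h1 : (√Real.pi)⁻¹ ≤ 1 :=
    inv_le_one_of_one_le₀ (Real.one_le_sqrt.2 (by linarith [Real.pi_gt_three]))
  have h2 : |z.re + z.im| ≤ 2 * ‖z‖ := by
    linarith [abs_add_le z.re z.im, Complex.abs_re_le_norm z, Complex.abs_im_le_norm z]
  have h3 := norm_cayleyCoeff_le_inv_sq n (cayleyWeight φ)
  rw [hartleyCoeff_apply, abs_mul, abs_of_nonneg (by positivity : 0 ≤ (√Real.pi)⁻¹), ← hz]
  calc (√Real.pi)⁻¹ * |z.re + z.im| ≤ 1 * (2 * ‖z‖) := by gcongr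
    _ ≤ _ := by linarith

/-- **Existence of the white noise probability measure**: there is a probability measure `P`
on `𝒮'(ℝ)` whose characteristic functional is the Gaussian functional
`φ ↦ exp(−½‖φ‖²_{L²(ℝ)})`. -/
theorem whiteNoiseMeasure_exists :
    ∃ P : Measure TemperedDistR, IsProbabilityMeasure P ∧
      ∀ φ : SchwartzR,
        ∫ ω, Complex.exp (Complex.I * ((ω φ : ℝ) : ℂ)) ∂P
          = Complex.exp (-(1/2) * ((∫ x, (φ x)^2 : ℝ) : ℂ)) := by
  have : BorelSpace TemperedDistR := ⟨rfl⟩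
  let p : Seminorm ℝ SchwartzR := (normSeminorm ℝ (Lp ℝ 1 (volume : Measure ℝ))).comp
    ((2 : ℝ) • (SchwartzMap.toLpCLM ℝ ℝ 1 volume ∘L cayleyElliptic ∘L cayleyWeight)).toLinearMap
  have hp : Continuous p := continuous_norm.comp
    ((2 : ℝ) • (SchwartzMap.toLpCLM ℝ ℝ 1 volume ∘L cayleyElliptic ∘L cayleyWeight)).continuous
  obtain ⟨P, hP, h⟩ := exists_gaussian_measure_weakDual hp
    (a := hartleyCoeff) (C := fun n : ℤ => (1 + 4 * (n : ℝ) ^ 2)⁻¹)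
    (fun n => by positivity) summable_inv_one_add_four_mul_sq
    (fun n φ => by
      refine (abs_hartleyCoeff_le n φ).trans_eq ?_
      congr 1
      exact (norm_smul_of_nonneg zero_le_two _).symm)
    hasSum_sq_hartleyCoeff
  exact ⟨P, hP, h⟩

end
end
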